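/- arXiv:1807.05413 — 2 statements merged into one kernel-verified Lean document; each statement's English description precedes it below -/
import Mathlib

section
/- For all integers m, n, k, j ≥ 0 and 1 ≤ r ≤ m with m+1 ≥ r + k, the (dinv, area) q,t-enumerators of doubly decorated reduced polyominoes satisfy the recursion RP_{q,t}(m∖r, n)^{∗k,j} = t^{m−r−k+1} Σ_{w=0}^{r} Σ_{s=0}^{n} q^{binom(w,2)} qbinom(r, w)_q qbinom(r+s−w−1, s−w)_q · RP_{q,t}((n−1)∖s, m−r+1)^{∗(j−w), k}, where binom(w,2) = w(w−1)/2. -/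
open Finset

attribute [local instance] Classical.propDecidable

noncomputable section

/-- The ring of polynomials in the two variables `q` and `t` with integer coefficients. -/
abbrev R2 : Type := MvPolynomial (Fin 2) ℤ

/-- The variable `q`. -/
def qv : R2 := MvPolynomial.X 0

/-- The variable `t`. -/
def tv : R2 := MvPolynomial.X 1

/-- The Gaussian binomial coefficient `[N choose k]_q`, defined via the q-Pascal
recursion `[N+1, k+1]_q = [N, k]_q + q^(k+1) [N, k+1]_q`; it agrees with
`[N]_q! / ([k]_q! [N-k]_q!)` for `0 ≤ k ≤ N` and vanishes for `k > N`. -/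
def qBinom : ℕ → ℕ → R2
  | _, 0 => 1
  | 0, _ + 1 => 0
  | N + 1, k + 1 => qBinom N k + qv ^ (k + 1) * qBinom N (k + 1)

/-- The Gaussian binomial coefficient with integer arguments:
it is `0` unless `0 ≤ k ≤ N`. -/
def qBinomZ (N k : ℤ) : R2 :=
  if 0 ≤ k ∧ k ≤ N then qBinom N.toNat k.toNat else 0

/-! ## Reduced parallelogram polyominoes: area-word model

The letters of the alphabet `0 < 0̄ < 1 < 1̄ < 2 < 2̄ < ⋯` are encoded as
natural numbers: `2v` is the unbarred letter of value `v` and `2v + 1` is the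
barred letter of value `v`; the successor in the alphabet is `+1`. -/

/-- Candidate objects: (area word, decorated unbarred rises, decorated barred
rises).  The area word of an `m × n` reduced polyomino has `m + n + 1` letters,
each bounded by its position. -/
abbrev RPCand (m n : ℕ) :=
  (Fin (m + n + 1) → Fin (2 * (m + n + 1))) ×
    Finset (Fin (m + n + 1)) × Finset (Fin (m + n + 1))

/-- `c` is the area word of an `m × n` reduced polyomino: it starts with the
unbarred letter `0`, whenever a letter is strictly smaller than the next one
the latter is its successor in the alphabet, and it has `m + 1` unbarred
letters and `n` barred letters. -/
def IsRPWord (m n : ℕ) (c : Fin (m + n + 1) → Fin (2 * (m + n + 1))) : Prop :=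
  (∀ i, i.1 = 0 → (c i : ℕ) = 0) ∧
    (∀ i j, j.1 = i.1 + 1 → (c j : ℕ) ≤ (c i : ℕ) + 1) ∧
    (univ.filter fun i => (c i : ℕ) % 2 = 0).card = m + 1 ∧
    (univ.filter fun i => (c i : ℕ) % 2 = 1).card = n

/-- An unbarred rise: an unbarred letter which is the successor (in the
alphabet) of the letter immediately to its left. -/
def IsUnbarredRise {L L' : ℕ} (c : Fin L → Fin L') (i : Fin L) : Prop :=
  (c i : ℕ) % 2 = 0 ∧ ∃ j : Fin L, i.1 = j.1 + 1 ∧ (c i : ℕ) = (c j : ℕ) + 1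

/-- A barred rise: a barred letter which is the successor (in the alphabet) of
the letter immediately to its left. -/
def IsBarredRise {L L' : ℕ} (c : Fin L → Fin L') (i : Fin L) : Prop :=
  (c i : ℕ) % 2 = 1 ∧ ∃ j : Fin L, i.1 = j.1 + 1 ∧ (c i : ℕ) = (c j : ℕ) + 1

/-- Membership in `RP(m∖r, n)^{∗k, j}`: an `m × n` reduced polyomino with `k`
decorated unbarred rises, `j` decorated barred rises, and exactly `r` letters
equal to `0` in its area word (including the initial one). -/
def IsRPstar (m n r k j : ℕ) (x : RPCand m n) : Prop :=
  IsRPWord m n x.1 ∧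
    (∀ i ∈ x.2.1, IsUnbarredRise x.1 i) ∧ x.2.1.card = k ∧
    (∀ i ∈ x.2.2, IsBarredRise x.1 i) ∧ x.2.2.card = j ∧
    (univ.filter fun i => (x.1 i : ℕ) = 0).card = r

/-- The area: the sum of the letters of the area word disregarding bars, not
counting decorated rises of either type. -/
def areaRPstar {m n : ℕ} (x : RPCand m n) : ℕ :=
  ∑ i ∈ univ.filter (fun i => i ∉ x.2.1 ∧ i ∉ x.2.2), (x.1 i : ℕ) / 2

/-- The dinv: the number of pairs `i < j` such that the `i`-th letter of the
area word is the successor, in the alphabet, of the `j`-th letter. -/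
def dinvRPstar {m n : ℕ} (x : RPCand m n) : ℕ :=
  (univ.filter fun p : Fin (m + n + 1) × Fin (m + n + 1) =>
    p.1 < p.2 ∧ (x.1 p.1 : ℕ) = (x.1 p.2 : ℕ) + 1).card

/-- The `(dinv, area)` q,t-enumerator `RP_{q,t}(m∖r, n)^{∗k, j}`;
it is `0` if some parameter is negative. -/
def RPdE (m n r k j : ℤ) : R2 :=
  if 0 ≤ m ∧ 0 ≤ n ∧ 0 ≤ r ∧ 0 ≤ k ∧ 0 ≤ j then
    ∑ x ∈ univ.filter (IsRPstar m.toNat n.toNat r.toNat k.toNat j.toNat),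
      qv ^ dinvRPstar x * tv ^ areaRPstar x
  else 0

/-! ## Gaussian binomials -/

theorem qBinom_zero_right (N : ℕ) : qBinom N 0 = 1 := by
  cases N <;> rfl

theorem qBinom_succ_succ (N k : ℕ) :
    qBinom (N + 1) (k + 1) = qBinom N k + qv ^ (k + 1) * qBinom N (k + 1) := rfl

theorem qBinom_eq_zero_of_lt : ∀ {N k : ℕ}, N < k → qBinom N k = 0
  | _, 0, h => by omega
  | 0, _ + 1, _ => rfl
  | N + 1, k + 1, h => by
    rw [qBinom_succ_succ, qBinom_eq_zero_of_lt (by omega : N < k),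
      qBinom_eq_zero_of_lt (by omega : N < k + 1)]
    ring

theorem qBinom_self (N : ℕ) : qBinom N N = 1 := by
  induction N with
  | zero => rfl
  | succ N ih => rw [qBinom_succ_succ, ih, qBinom_eq_zero_of_lt (Nat.lt_succ_self N)]; ring

/-- The second `q`-Pascal rule. -/
theorem qBinom_add_succ_succ : ∀ a b : ℕ,
    qBinom (a + b + 1) (a + 1) = qv ^ b * qBinom (a + b) a + qBinom (a + b) (a + 1)
  | a, 0 => by
    simp [qBinom_self, qBinom_eq_zero_of_lt (Nat.lt_succ_self a)]
  | 0, b + 1 => by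
    have h := qBinom_add_succ_succ 0 b
    have h1 := qBinom_succ_succ (0 + (b + 1)) 0
    have h2 := qBinom_succ_succ (0 + b) 0
    simp only [qBinom_zero_right, ← Nat.add_assoc] at *
    rw [h1]
    rw [h2] at h ⊢
    linear_combination qv * h
  | a + 1, b + 1 => by
    have h1 := qBinom_add_succ_succ a (b + 1)
    have h2 := qBinom_add_succ_succ (a + 1) b
    have e1 := qBinom_succ_succ (a + 1 + (b + 1)) (a + 1)
    have e2 := qBinom_succ_succ (a + 1 + b) a
    have e3 := qBinom_succ_succ (a + 1 + b) (a + 1)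
    rw [show a + 1 + (b + 1) = a + 1 + b + 1 by ring] at *
    rw [show a + (b + 1) = a + 1 + b by ring] at *
    rw [e1]
    linear_combination h1 + qv ^ (a + 2) * h2 - qv ^ (b + 1) * e2 - e3

theorem qBinom_symm_add : ∀ a b : ℕ, qBinom (a + b) a = qBinom (a + b) b
  | a, 0 => by simp [qBinom_self, qBinom_zero_right]
  | 0, b + 1 => by simp [qBinom_self, qBinom_zero_right]
  | a + 1, b + 1 => by
    have h1 := qBinom_symm_add a (b + 1)
    have h2 := qBinom_symm_add (a + 1) b
    have e1 := qBinom_add_succ_succ b (a + 1)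
    have e2 := qBinom_succ_succ (a + 1 + b) a
    rw [show a + 1 + (b + 1) = a + 1 + b + 1 by ring]
    rw [show b + (a + 1) = a + 1 + b by ring] at e1
    rw [show a + (b + 1) = a + 1 + b by ring] at h1
    rw [e1, e2, h1, h2]
    ring

/-- The sum of `q ^ inv` over binary words with `r` zeros and `s` ones, in which `w` of the ones
that immediately follow a zero are decorated. -/
def anyStart (s r w : ℕ) : R2 :=
  if w ≤ s then qv ^ (w * (w - 1) / 2) * qBinom r w * qBinom (r + s - w) r else 0

/-- The analogue of `anyStart` for words to which an initial zero is prepended. -/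
def zeroStart (s r w : ℕ) : R2 :=
  if w ≤ s then qv ^ (w * (w - 1) / 2) * qBinom (r + 1) w * qBinom (r + s - w) r else 0

theorem anyStart_zero (r w : ℕ) : anyStart 0 r w = if w = 0 then 1 else 0 := by
  by_cases h : w = 0
  · simp [anyStart, h, qBinom_zero_right, qBinom_self]
  · simp [anyStart, h]

theorem zeroStart_zero (r w : ℕ) : zeroStart 0 r w = if w = 0 then 1 else 0 := by
  by_cases h : w = 0
  · simp [zeroStart, h, qBinom_zero_right, qBinom_self]
  · simp [zeroStart, h]

theorem anyStart_succ_zero (s w : ℕ) : anyStart (s + 1) 0 w = anyStart s 0 w := by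
  rcases w with _ | w
  · simp [anyStart, qBinom_zero_right]
  · simp [anyStart, qBinom]

theorem anyStart_succ_succ (s r w : ℕ) :
    anyStart (s + 1) (r + 1) w
      = zeroStart (s + 1) r w + qv ^ (r + 1) * anyStart s (r + 1) w := by
  unfold anyStart zeroStart
  rcases Nat.lt_trichotomy w (s + 1) with h | rfl | h
  · obtain ⟨d, rfl⟩ := Nat.exists_eq_add_of_le (Nat.lt_succ_iff.mp h)
    have e := qBinom_succ_succ (r + 1 + d) r
    rw [if_pos (by omega), if_pos (by omega), if_pos (by omega),
      show r + 1 + (w + d + 1) - w = r + 1 + d + 1 by omega,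
      show r + (w + d + 1) - w = r + 1 + d by omega,
      show r + 1 + (w + d) - w = r + 1 + d by omega, e]
    ring
  · simp [qBinom_self]
  · rw [if_neg (by omega), if_neg (by omega), if_neg (by omega)]
    ring

theorem zeroStart_zero_right (s r : ℕ) :
    zeroStart s r 0 = anyStart s r 0 := by
  simp [anyStart, zeroStart, qBinom_zero_right]

theorem zeroStart_succ_succ (s r w : ℕ) :
    zeroStart (s + 1) r (w + 1)
      = anyStart (s + 1) r (w + 1) + qv ^ r * anyStart s r w := by
  unfold anyStart zeroStart
  by_cases h : w ≤ s
  · rw [if_pos (by omega), if_pos (by omega), if_pos h,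
      show r + (s + 1) - (w + 1) = r + s - w by omega]
    have hc : (w + 1) * (w + 1 - 1) / 2 = w * (w - 1) / 2 + w := by
      rw [← Nat.triangle_succ]
    rcases Nat.lt_or_ge r w with hr | hr
    · rw [qBinom_eq_zero_of_lt (by omega : r + 1 < w + 1),
        qBinom_eq_zero_of_lt (by omega : r < w + 1), qBinom_eq_zero_of_lt hr]
      ring
    · obtain ⟨b, rfl⟩ := Nat.exists_eq_add_of_le hr
      rw [qBinom_add_succ_succ, hc]
      ring
  · rw [if_neg (by omega), if_neg (by omega), if_neg h]
    ring

theorem qBinomZ_mul_eq_zeroStart (s r w : ℕ) :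
    qv ^ (w * (w - 1) / 2) * qBinomZ ((r + 1 : ℕ) : ℤ) (w : ℤ) *
      qBinomZ (((r + 1 : ℕ) : ℤ) + (s : ℤ) - (w : ℤ) - 1) ((s : ℤ) - (w : ℤ)) =
      zeroStart s r w := by
  unfold zeroStart
  by_cases h : w ≤ s
  · obtain ⟨d, rfl⟩ := Nat.exists_eq_add_of_le h
    rw [if_pos h, show r + (w + d) - w = r + d by omega, qBinom_symm_add r d,
      show ((r + 1 : ℕ) : ℤ) + ((w + d : ℕ) : ℤ) - (w : ℤ) - 1 = ((r + d : ℕ) : ℤ) by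
        push_cast; ring,
      show ((w + d : ℕ) : ℤ) - (w : ℤ) = (d : ℤ) by push_cast; ring]
    have h1 : qBinomZ ((r + d : ℕ) : ℤ) (d : ℤ) = qBinom (r + d) d := by
      unfold qBinomZ
      rw [if_pos ⟨by omega, by omega⟩]
      simp only [Int.toNat_natCast]
    have h2 : qBinomZ ((r + 1 : ℕ) : ℤ) (w : ℤ) = qBinom (r + 1) w := by
      unfold qBinomZ
      by_cases hw : w ≤ r + 1
      · rw [if_pos ⟨by omega, by omega⟩]
        simp only [Int.toNat_natCast]
      · rw [if_neg (by omega), qBinom_eq_zero_of_lt (by omega)]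
    rw [h1, h2]
  · rw [if_neg h]
    have : qBinomZ (((r + 1 : ℕ) : ℤ) + (s : ℤ) - (w : ℤ) - 1) ((s : ℤ) - (w : ℤ)) = 0 := by
      unfold qBinomZ
      rw [if_neg (by omega)]
    rw [this, mul_zero]

/-! ## Weighted enumeration of finite families -/

/-- The family cut out by `P` is finite, with total weight `v` under `f`. -/
def Enumerates {α : Type*} (P : α → Prop) (f : α → R2) (v : R2) : Prop :=
  ∃ S : Finset α, (∀ x, x ∈ S ↔ P x) ∧ ∑ x ∈ S, f x = v

namespace Enumerates

variable {α β ι : Type*} {P Q R : α → Prop} {f : α → R2} {a b : R2}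

theorem unique (ha : Enumerates P f a) (hb : Enumerates P f b) : a = b := by
  obtain ⟨S, hS, rfl⟩ := ha
  obtain ⟨T, hT, rfl⟩ := hb
  rw [show S = T from Finset.ext fun x => (hS x).trans (hT x).symm]

theorem congr (h : Enumerates P f a) (hPQ : ∀ x, Q x ↔ P x) : Enumerates Q f a := by
  obtain ⟨S, hS, hv⟩ := h
  exact ⟨S, fun x => (hS x).trans (hPQ x).symm, hv⟩

theorem of_forall_not (h : ∀ x, ¬ P x) : Enumerates P f 0 :=
  ⟨∅, fun x => by simp [h x], by simp⟩

theorem singleton (x : α) (h : ∀ y, P y ↔ y = x) : Enumerates P f (f x) :=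
  ⟨{x}, fun y => by simp [h y], by simp⟩

theorem add (hP : Enumerates P f a) (hQ : Enumerates Q f b) (hd : ∀ x, P x → ¬ Q x)
    (hR : ∀ x, R x ↔ P x ∨ Q x) : Enumerates R f (a + b) := by
  obtain ⟨S, hS, rfl⟩ := hP
  obtain ⟨T, hT, rfl⟩ := hQ
  refine ⟨S ∪ T, fun x => by rw [Finset.mem_union, hS, hT, hR], Finset.sum_union ?_⟩
  rw [Finset.disjoint_left]
  exact fun x hx hx' => hd x ((hS x).1 hx) ((hT x).1 hx')

theorem image {Q : β → Prop} {g : β → R2} (φ : α → β) (c : R2) (hP : Enumerates P f a)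
    (hinj : ∀ x y, P x → P y → φ x = φ y → x = y) (hw : ∀ x, P x → g (φ x) = c * f x)
    (hQ : ∀ y, Q y ↔ ∃ x, P x ∧ y = φ x) : Enumerates Q g (c * a) := by
  obtain ⟨S, hS, rfl⟩ := hP
  refine ⟨S.image φ, fun y => ?_, ?_⟩
  · rw [Finset.mem_image, hQ]
    exact exists_congr fun x => and_congr (hS x) eq_comm
  · rw [Finset.sum_image fun x hx y hy h => hinj x y ((hS x).1 hx) ((hS y).1 hy) h,
      Finset.mul_sum]
    exact Finset.sum_congr rfl fun x hx => hw x ((hS x).1 hx)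

theorem sum (I : Finset ι) (ℓ : α → ι) (v : ι → R2) (hℓ : ∀ x, P x → ℓ x ∈ I)
    (h : ∀ i ∈ I, Enumerates (fun x => P x ∧ ℓ x = i) f (v i)) :
    Enumerates P f (∑ i ∈ I, v i) := by
  have h' : ∀ i, ∃ S : Finset α, i ∈ I → (∀ x, x ∈ S ↔ P x ∧ ℓ x = i) ∧ ∑ x ∈ S, f x = v i := by
    intro i
    by_cases hi : i ∈ I
    · obtain ⟨S, hS⟩ := h i hi
      exact ⟨S, fun _ => hS⟩
    · exact ⟨∅, fun hi' => absurd hi' hi⟩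
  choose S hS using h'
  refine ⟨I.biUnion S, fun x => ?_, ?_⟩
  · rw [Finset.mem_biUnion]
    constructor
    · rintro ⟨i, hi, hx⟩
      exact (((hS i hi).1 x).1 hx).1
    · exact fun hx => ⟨ℓ x, hℓ x hx, ((hS _ (hℓ x hx)).1 x).2 ⟨hx, rfl⟩⟩
  · rw [Finset.sum_biUnion]
    · exact Finset.sum_congr rfl fun i hi => (hS i hi).2
    · intro i hi j hj hij
      rw [Function.onFun, Finset.disjoint_left]
      intro x hx hx'
      exact hij ((((hS i hi).1 x).1 hx).2.symm.trans (((hS j hj).1 x).1 hx').2)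

theorem fiber {Q : β → Prop} {g : β → R2} {v : R2} (hQ : Enumerates Q g v) (c : R2) (ℓ : α → β)
    (hℓ : ∀ x, P x → Q (ℓ x))
    (h : ∀ y, Q y → Enumerates (fun x => P x ∧ ℓ x = y) f (c * g y)) :
    Enumerates P f (c * v) := by
  obtain ⟨T, hT, rfl⟩ := hQ
  rw [Finset.mul_sum]
  exact sum T ℓ _ (fun x hx => (hT _).2 (hℓ x hx)) fun y hy => h y ((hT y).1 hy)

end Enumerates

/-! ## Decorated words as lists -/

/-- The number of letters of `l` satisfying `p`. -/
def cnt (p : ℕ × Bool → Prop) (l : List (ℕ × Bool)) : ℕ :=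
  (l.map fun x => if p x then 1 else 0).sum

@[simp] theorem cnt_nil (p : ℕ × Bool → Prop) : cnt p [] = 0 := rfl

@[simp] theorem cnt_cons (p : ℕ × Bool → Prop) (x : ℕ × Bool) (l : List (ℕ × Bool)) :
    cnt p (x :: l) = (if p x then 1 else 0) + cnt p l := by
  simp [cnt]

/-- The letters of `l` form, after a letter `p`, an area word whose decorated letters are rises. -/
def Follows : ℕ → List (ℕ × Bool) → Prop
  | _, [] => True
  | p, x :: l => x.1 ≤ p + 1 ∧ (x.2 = true → x.1 = p + 1) ∧ Follows x.1 l

/-- The number of pairs in which the left letter is the successor of the right one. -/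
def dinvList : List (ℕ × Bool) → ℕ
  | [] => 0
  | x :: l => cnt (fun y => x.1 = y.1 + 1) l + dinvList l

/-- The number of pairs consisting of a `1` to the left of a `0`. -/
def invList : List (ℕ × Bool) → ℕ
  | [] => 0
  | x :: l => (if x.1 = 1 then cnt (fun y => y.1 = 0) l else 0) + invList l

/-- The sum of the values of the undecorated letters. -/
def areaList (l : List (ℕ × Bool)) : ℕ :=
  (l.map fun x => if x.2 = true then 0 else x.1 / 2).sum

@[simp] theorem areaList_nil : areaList [] = 0 := rfl

@[simp] theorem areaList_cons (x : ℕ × Bool) (l : List (ℕ × Bool)) :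
    areaList (x :: l) = (if x.2 = true then 0 else x.1 / 2) + areaList l := by
  simp [areaList]

/-- Delete the letters `0` and replace every other letter by its predecessor, forgetting the
decorations of the letters that become `0`. -/
def reduce : List (ℕ × Bool) → List (ℕ × Bool)
  | [] => []
  | (0, _) :: l => reduce l
  | (1, _) :: l => (0, false) :: reduce l
  | (a + 2, d) :: l => (a + 1, d) :: reduce l

/-- `y` can be the reduction of a word following a letter `p`. -/
def ReductFollows (p : ℕ) (y : List (ℕ × Bool)) : Prop :=
  (p = 0 ∧ (y = [] ∨ ∃ y', y = (0, false) :: y' ∧ Follows 0 y')) ∨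
    (∃ p', p = p' + 1 ∧ Follows p' y)

theorem reductFollows_reduce : ∀ {p : ℕ} {l : List (ℕ × Bool)}, Follows p l →
    ReductFollows p (reduce l)
  | 0, [], _ => Or.inl ⟨rfl, Or.inl rfl⟩
  | p + 1, [], _ => Or.inr ⟨p, rfl, trivial⟩
  | 0, (0, d) :: l, h => by
    have h' : Follows 0 l := h.2.2
    have ih : ReductFollows 0 (reduce l) := reductFollows_reduce h'
    exact ih
  | p + 1, (0, d) :: l, h => by
    refine Or.inr ⟨p, rfl, ?_⟩
    rcases reductFollows_reduce h.2.2 with ⟨_, h' | ⟨y', h', hy'⟩⟩ | ⟨p', hp', _⟩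
    · simp only [reduce, h']; trivial
    · simp only [reduce, h']
      exact ⟨by simp, by simp, hy'⟩
    · exact absurd hp' (by simp)
  | p, (1, d) :: l, h => by
    have key : Follows 0 (reduce l) := by
      rcases reductFollows_reduce h.2.2 with ⟨h', _⟩ | ⟨p', hp', h'⟩
      · simp at h'
      · obtain rfl : p' = 0 := by simpa using hp'.symm
        exact h'
    rcases p with _ | p
    · exact Or.inl ⟨rfl, Or.inr ⟨_, rfl, key⟩⟩
    · exact Or.inr ⟨p, rfl, by simp, by simp, key⟩
  | p, (a + 2, d) :: l, h => by
    obtain ⟨h1, h2, h3⟩ := h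
    obtain ⟨p', rfl⟩ : ∃ p', p = p' + 1 := ⟨p - 1, by simp at h1; omega⟩
    refine Or.inr ⟨p', rfl, by simp at h1 ⊢; omega, fun hd => ?_, ?_⟩
    · have := h2 hd
      simp at this ⊢
      omega
    rcases reductFollows_reduce h3 with ⟨h', _⟩ | ⟨b, hp', h'⟩
    · simp at h'
    · obtain rfl : a + 1 = b := by simpa using hp'
      exact h'

theorem cnt_even_eq (l : List (ℕ × Bool)) :
    cnt (fun x => x.1 % 2 = 0) l
      = cnt (fun x => x.1 = 0) l + cnt (fun x => x.1 % 2 = 1) (reduce l) := by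
  induction l using reduce.induct <;> grind [reduce, cnt_cons, cnt_nil]

theorem cnt_odd_eq (l : List (ℕ × Bool)) :
    cnt (fun x => x.1 % 2 = 1) l = cnt (fun x => x.1 % 2 = 0) (reduce l) := by
  induction l using reduce.induct <;> grind [reduce, cnt_cons, cnt_nil]

theorem cnt_one_eq (l : List (ℕ × Bool)) :
    cnt (fun x => x.1 = 1) l = cnt (fun x => x.1 = 0) (reduce l) := by
  induction l using reduce.induct <;> grind [reduce, cnt_cons, cnt_nil]

theorem cnt_decorated_odd_eq (l : List (ℕ × Bool)) :
    cnt (fun x => x.2 = true ∧ x.1 % 2 = 1) l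
      = cnt (fun x => x.2 = true ∧ x.1 = 1) l
        + cnt (fun x => x.2 = true ∧ x.1 % 2 = 0) (reduce l) := by
  induction l using reduce.induct <;> grind [reduce, cnt_cons, cnt_nil]

theorem cnt_decorated_even_eq {p : ℕ} {l : List (ℕ × Bool)} (h : Follows p l) :
    cnt (fun x => x.2 = true ∧ x.1 % 2 = 0) l
      = cnt (fun x => x.2 = true ∧ x.1 % 2 = 1) (reduce l) := by
  induction l using reduce.induct generalizing p <;> grind [reduce, cnt_cons, cnt_nil, Follows]

theorem cnt_succ_reduce (a : ℕ) (l : List (ℕ × Bool)) :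
    cnt (fun y => a + 2 = y.1 + 1) l = cnt (fun y => a + 1 = y.1 + 1) (reduce l) := by
  induction l using reduce.induct <;> simp_all [reduce]

theorem dinvList_eq (l : List (ℕ × Bool)) : dinvList l = dinvList (reduce l) + invList l := by
  have h0 (l : List (ℕ × Bool)) : cnt (fun y => 0 = y.1 + 1) l = 0 := by
    induction l <;> simp_all
  have h1 (l : List (ℕ × Bool)) :
      cnt (fun y => 1 = y.1 + 1) l = cnt (fun y => y.1 = 0) l := by
    congr 1
    funext y
    simp
  induction l using reduce.induct with
  | case1 => rfl
  | case2 d l ih => simp only [reduce, dinvList, invList, h0, ih]; simp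
  | case3 d l ih => simp only [reduce, dinvList, invList, h0, h1, ih]; simp; omega
  | case4 a d l ih => simp only [reduce, dinvList, invList, cnt_succ_reduce, ih]; simp; omega

theorem areaList_eq {p : ℕ} {l : List (ℕ × Bool)} (h : Follows p l) :
    areaList l + cnt (fun x => x.2 = true ∧ x.1 % 2 = 0) l + cnt (fun x => x.1 = 0) l
      = areaList (reduce l) + cnt (fun x => x.1 % 2 = 0) l := by
  induction l using reduce.induct generalizing p <;>
    grind [reduce, cnt_cons, cnt_nil, Follows, areaList_cons, areaList_nil]

theorem cnt_decorated_one_le {p : ℕ} {l : List (ℕ × Bool)} (h : Follows p l) :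
    cnt (fun x => x.2 = true ∧ x.1 = 1) l
      ≤ cnt (fun x => x.1 = 0) l + (if p = 0 then 1 else 0) := by
  induction l generalizing p <;> grind [cnt_cons, cnt_nil, Follows]

theorem cnt_one_le_cnt_odd (l : List (ℕ × Bool)) :
    cnt (fun x => x.1 = 1) l ≤ cnt (fun x => x.1 % 2 = 1) l := by
  induction l <;> grind [cnt_cons, cnt_nil]

/-! ## The words with a given reduction -/

/-- `l` follows a letter `p`, reduces to `y`, and has `r` letters `0` and `w` decorated
letters `1`. -/
def InFiber (p : ℕ) (y : List (ℕ × Bool)) (r w : ℕ) (l : List (ℕ × Bool)) : Prop :=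
  Follows p l ∧ reduce l = y ∧ cnt (fun x => x.1 = 0) l = r ∧
    cnt (fun x => x.2 = true ∧ x.1 = 1) l = w

theorem inFiber_nil_iff {p r w : ℕ} {y : List (ℕ × Bool)} :
    InFiber p y r w [] ↔ y = [] ∧ r = 0 ∧ w = 0 := by
  grind [InFiber, Follows, reduce, cnt_nil]

theorem inFiber_zero_cons_iff {p r w : ℕ} {d : Bool} {y l : List (ℕ × Bool)} :
    InFiber p y r w ((0, d) :: l) ↔ d = false ∧ ∃ r', r = r' + 1 ∧ InFiber 0 y r' w l := by
  cases r <;> cases d <;> grind [InFiber, Follows, reduce, cnt_cons]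

theorem inFiber_one_cons_iff {p r w : ℕ} {d : Bool} {y l : List (ℕ × Bool)} :
    InFiber p y r w ((1, d) :: l) ↔ (d = true → p = 0) ∧ ∃ y', y = (0, false) :: y' ∧
      ∃ w', w = w' + (if d = true then 1 else 0) ∧ InFiber 1 y' r w' l := by
  cases w <;> cases d <;> grind [InFiber, Follows, reduce, cnt_cons]

theorem inFiber_add_two_cons_iff {p r w a : ℕ} {d : Bool} {y l : List (ℕ × Bool)} :
    InFiber p y r w ((a + 2, d) :: l) ↔ a + 2 ≤ p + 1 ∧ (d = true → a + 2 = p + 1) ∧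
      ∃ y', y = (a + 1, d) :: y' ∧ InFiber (a + 2) y' r w l := by
  grind [InFiber, Follows, reduce, cnt_cons]

theorem Enumerates.cons {P : List (ℕ × Bool) → Prop} {v : R2} (x : ℕ × Bool) (c : ℕ)
    (h : Enumerates P (fun l => qv ^ invList l) v)
    (hc : ∀ l, P l → invList (x :: l) = c + invList l) :
    Enumerates (fun l => ∃ l', P l' ∧ l = x :: l') (fun l => qv ^ invList l) (qv ^ c * v) :=
  h.image (List.cons x) (qv ^ c) (fun _ _ _ _ e => (List.cons.inj e).2)
    (fun l hl => by rw [hc l hl, pow_add]) fun _ => Iff.rfl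

theorem enumerates_inFiber_nil (r p w : ℕ) :
    Enumerates (InFiber p [] r w) (fun l => qv ^ invList l) (if w = 0 then 1 else 0) := by
  induction r generalizing p with
  | zero =>
    have key : ∀ l, InFiber p [] 0 w l ↔ l = [] ∧ w = 0 := by
      rintro (_ | ⟨⟨_ | _ | a, d⟩, l⟩)
      · simp [inFiber_nil_iff]
      · simp [inFiber_zero_cons_iff]
      · simp [inFiber_one_cons_iff]
      · simp [inFiber_add_two_cons_iff]
    by_cases hw : w = 0
    · rw [if_pos hw]
      have := Enumerates.singleton (P := InFiber p [] 0 w) (f := fun l => qv ^ invList l) []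
        fun l => by rw [key]; simp [hw]
      simpa [invList] using this
    · rw [if_neg hw]
      exact Enumerates.of_forall_not fun l => by simp [key, hw]
  | succ r ih =>
    have h := (ih 0).cons (0, false) 0 (by simp [invList])
    rw [pow_zero, one_mul] at h
    refine h.congr ?_
    rintro (_ | ⟨⟨_ | _ | a, d⟩, l⟩)
    · simp [inFiber_nil_iff]
    · simp [inFiber_zero_cons_iff, and_comm]
    · simp [inFiber_one_cons_iff]
    · simp [inFiber_add_two_cons_iff]

theorem enumerates_inFiber_zero_cons {y : List (ℕ × Bool)} {s : ℕ}
    (hy : ∀ r w, Enumerates (InFiber 1 y r w) (fun l => qv ^ invList l) (anyStart s r w))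
    (r p w : ℕ) :
    Enumerates (InFiber p ((0, false) :: y) r w) (fun l => qv ^ invList l)
      (if p = 0 then zeroStart (s + 1) r w else anyStart (s + 1) r w) := by
  have hone (r w : ℕ) (d : Bool) := (hy r w).cons (1, d) r fun l hl => by
    simp [invList, hl.2.2.1]
  induction r using Nat.strong_induction_on generalizing p w with
  | _ r ih
  suffices hZU : ∀ w, Enumerates (fun l =>
      (∃ l', (∃ r', r = r' + 1 ∧ InFiber 0 ((0, false) :: y) r' w l') ∧ l = (0, false) :: l') ∨
        (∃ l', InFiber 1 y r w l' ∧ l = (1, false) :: l'))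
      (fun l => qv ^ invList l) (anyStart (s + 1) r w) by
    by_cases hpw : p = 0 ∧ w ≠ 0
    · obtain ⟨rfl, hw⟩ := hpw
      obtain ⟨w, rfl⟩ := Nat.exists_eq_succ_of_ne_zero hw
      rw [if_pos rfl, Nat.succ_eq_add_one, zeroStart_succ_succ]
      refine (hZU (w + 1)).add (hone r w true) ?_ ?_
      · rintro l (⟨l', _, rfl⟩ | ⟨l', _, rfl⟩) <;> simp
      · rintro (_ | ⟨⟨_ | _ | a, d⟩, l⟩)
        · simp [inFiber_nil_iff]
        · simp [inFiber_zero_cons_iff, and_comm]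
        · cases d <;> simp [inFiber_one_cons_iff]
        · simp [inFiber_add_two_cons_iff]
    · rw [show (if p = 0 then zeroStart (s + 1) r w else anyStart (s + 1) r w)
          = anyStart (s + 1) r w by
        split_ifs with hp
        · obtain rfl : w = 0 := by tauto
          exact zeroStart_zero_right _ _
        · rfl]
      refine (hZU w).congr ?_
      rintro (_ | ⟨⟨_ | _ | a, d⟩, l⟩)
      · simp [inFiber_nil_iff]
      · simp [inFiber_zero_cons_iff, and_comm]
      · cases d
        · simp [inFiber_one_cons_iff]
        · have : p = 0 → w ≠ 0 → False := fun h h' => hpw ⟨h, h'⟩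
          simp [inFiber_one_cons_iff]
          grind
      · simp [inFiber_add_two_cons_iff]
  intro w
  rcases r with _ | r
  · have hU := hone 0 w false
    rw [pow_zero, one_mul, ← anyStart_succ_zero] at hU
    refine hU.congr ?_
    simp
  · have hZ := (ih r (Nat.lt_succ_self r) 0 w).cons (0, false) 0 (by simp [invList])
    rw [pow_zero, one_mul, if_pos rfl] at hZ
    rw [anyStart_succ_succ]
    refine hZ.add (hone (r + 1) w false) ?_ fun l => by simp
    rintro l ⟨l', _, rfl⟩
    simp

theorem enumerates_inFiber (y : List (ℕ × Bool)) (r p w : ℕ) (hy : ReductFollows p y) :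
    Enumerates (InFiber p y r w) (fun l => qv ^ invList l)
      (if p = 0 then zeroStart (cnt (fun x => x.1 = 0) y) r w
        else anyStart (cnt (fun x => x.1 = 0) y) r w) := by
  induction y generalizing r p w with
  | nil =>
    have := enumerates_inFiber_nil r p w
    rw [cnt_nil, zeroStart_zero, anyStart_zero, ite_self]
    exact this
  | cons x y ihy =>
    obtain ⟨_ | a, e⟩ := x
    · obtain ⟨rfl, hy0⟩ : e = false ∧ Follows 0 y := by
        rcases hy with ⟨_, h | ⟨y', h, hy'⟩⟩ | ⟨p', _, h⟩
        · simp at h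
        · simp only [List.cons.injEq, Prod.mk.injEq, true_and] at h
          exact ⟨h.1, h.2 ▸ hy'⟩
        · refine ⟨?_, h.2.2⟩
          have := h.2.1
          simpa using this
      have hy1 : ReductFollows 1 y := Or.inr ⟨0, rfl, hy0⟩
      have h := enumerates_inFiber_zero_cons (fun r w => by simpa using ihy r 1 w hy1) r p w
      simpa [add_comm] using h
    · obtain ⟨p', rfl, h1, h2, h3⟩ : ∃ p', p = p' + 1 ∧ a + 1 ≤ p' + 1 ∧
          (e = true → a + 1 = p' + 1) ∧ Follows (a + 1) y := by
        rcases hy with ⟨_, h | ⟨y', h, hy'⟩⟩ | ⟨p', hp, h⟩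
        · simp at h
        · simp at h
        · exact ⟨p', hp, h⟩
      have h := (ihy r (a + 2) w (Or.inr ⟨_, rfl, h3⟩)).cons (a + 2, e) 0 (by simp [invList])
      rw [pow_zero, one_mul, if_neg (by omega)] at h
      rw [if_neg (by omega), cnt_cons, if_neg (by simp), zero_add]
      refine h.congr ?_
      rintro (_ | ⟨⟨_ | _ | b, d⟩, l⟩)
      · simp [inFiber_nil_iff]
      · simp only [inFiber_zero_cons_iff]
        constructor
        · rintro ⟨_, r', _, hl⟩
          have := reductFollows_reduce hl.1
          rw [hl.2.1] at this
          simp [ReductFollows] at this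
        · simp
      · simp [inFiber_one_cons_iff]
      · simp only [inFiber_add_two_cons_iff]
        constructor
        · rintro ⟨_, _, y', hy', hl⟩
          simp only [List.cons.injEq, Prod.mk.injEq, Nat.add_right_cancel_iff] at hy'
          obtain ⟨⟨rfl, rfl⟩, rfl⟩ := hy'
          exact ⟨l, hl, rfl⟩
        · rintro ⟨l', hl, hl'⟩
          simp only [List.cons.injEq, Prod.mk.injEq, Nat.add_right_cancel_iff] at hl'
          obtain ⟨⟨rfl, rfl⟩, rfl⟩ := hl'
          exact ⟨by omega, fun hd => by have := h2 hd; omega, y, rfl, hl⟩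

/-! ## Area words as lists -/

/-- The list form of membership in `RP(m∖r, n)^{∗k, j}`. -/
def IsWordList (m n r k j : ℕ) (L : List (ℕ × Bool)) : Prop :=
  (∃ l, L = (0, false) :: l ∧ Follows 0 l) ∧
    cnt (fun x => x.1 % 2 = 0) L = m + 1 ∧ cnt (fun x => x.1 % 2 = 1) L = n ∧
    cnt (fun x => x.2 = true ∧ x.1 % 2 = 0) L = k ∧
    cnt (fun x => x.2 = true ∧ x.1 % 2 = 1) L = j ∧ cnt (fun x => x.1 = 0) L = r

theorem follows_ofFn {N : ℕ} (f : Fin (N + 1) → ℕ × Bool) :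
    Follows (f 0).1 (List.ofFn fun i : Fin N => f i.succ) ↔
      ∀ i : Fin N, (f i.succ).1 ≤ (f i.castSucc).1 + 1 ∧
        ((f i.succ).2 = true → (f i.succ).1 = (f i.castSucc).1 + 1) := by
  induction N with
  | zero => simp [Follows]
  | succ N ih =>
    have := ih fun i => f i.succ
    rw [List.ofFn_succ, Fin.forall_fin_succ, Follows, this, ← and_assoc]
    rfl

theorem cnt_ofFn {N : ℕ} (p : ℕ × Bool → Prop) (f : Fin N → ℕ × Bool) :
    cnt p (List.ofFn f) = (univ.filter fun i => p (f i)).card := by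
  rw [cnt, List.map_ofFn, List.sum_ofFn, card_filter]
  rfl

theorem dinvList_ofFn {N : ℕ} (f : Fin N → ℕ × Bool) :
    dinvList (List.ofFn f) =
      (univ.filter fun p : Fin N × Fin N => p.1 < p.2 ∧ (f p.1).1 = (f p.2).1 + 1).card := by
  simp only [card_filter, Fintype.sum_prod_type]
  induction N with
  | zero => rfl
  | succ N ih =>
    rw [List.ofFn_succ, dinvList, ih, cnt_ofFn, card_filter]
    simp only [Fin.sum_univ_succ]
    simp [-Finset.sum_boole]
    congr!

theorem isWordList_ofFn {m n r k j : ℕ} (f : Fin (m + n + 1) → ℕ × Bool) :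
    IsWordList m n r k j (List.ofFn f) ↔
      (f 0 = (0, false) ∧ ∀ i : Fin (m + n), (f i.succ).1 ≤ (f i.castSucc).1 + 1 ∧
        ((f i.succ).2 = true → (f i.succ).1 = (f i.castSucc).1 + 1)) ∧
      (univ.filter fun i => (f i).1 % 2 = 0).card = m + 1 ∧
      (univ.filter fun i => (f i).1 % 2 = 1).card = n ∧
      (univ.filter fun i => (f i).2 = true ∧ (f i).1 % 2 = 0).card = k ∧
      (univ.filter fun i => (f i).2 = true ∧ (f i).1 % 2 = 1).card = j ∧
      (univ.filter fun i => (f i).1 = 0).card = r := by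
  rw [IsWordList]
  refine and_congr ?_ (Iff.of_eq (by simp only [cnt_ofFn]; congr!))
  rw [← follows_ofFn, List.ofFn_succ]
  constructor
  · rintro ⟨l, hl, h⟩
    obtain ⟨h0, rfl⟩ := List.cons.inj hl
    exact ⟨h0, by rwa [h0]⟩
  · rintro ⟨h0, h⟩
    exact ⟨_, by rw [h0], by rwa [h0] at h⟩

theorem IsWordList.length_eq {m n r k j : ℕ} {L : List (ℕ × Bool)}
    (h : IsWordList m n r k j L) : L.length = m + n + 1 := by
  have key (l : List (ℕ × Bool)) : l.length
      = cnt (fun x => x.1 % 2 = 0) l + cnt (fun x => x.1 % 2 = 1) l := by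
    induction l <;> grind [cnt_cons, cnt_nil]
  rw [key, h.2.1, h.2.2.1]
  ring

/-- The letters of an area word together with whether they are decorated. -/
def decoratedLetters {m n : ℕ} (x : RPCand m n) (i : Fin (m + n + 1)) : ℕ × Bool :=
  (x.1 i, decide (i ∈ x.2.1 ∨ i ∈ x.2.2))

theorem IsRPstar.mem_left_iff {m n r k j : ℕ} {x : RPCand m n} (h : IsRPstar m n r k j x)
    (i : Fin (m + n + 1)) :
    i ∈ x.2.1 ↔ (decoratedLetters x i).2 = true ∧ (decoratedLetters x i).1 % 2 = 0 := by
  have h1 := fun hi => (h.2.1 i hi).1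
  have h2 := fun hi => (h.2.2.2.1 i hi).1
  simp only [decoratedLetters, decide_eq_true_eq]
  grind

theorem IsRPstar.mem_right_iff {m n r k j : ℕ} {x : RPCand m n} (h : IsRPstar m n r k j x)
    (i : Fin (m + n + 1)) :
    i ∈ x.2.2 ↔ (decoratedLetters x i).2 = true ∧ (decoratedLetters x i).1 % 2 = 1 := by
  have h1 := fun hi => (h.2.1 i hi).1
  have h2 := fun hi => (h.2.2.2.1 i hi).1
  simp only [decoratedLetters, decide_eq_true_eq]
  grind

theorem dinvList_decoratedLetters {m n : ℕ} (x : RPCand m n) :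
    dinvList (List.ofFn (decoratedLetters x)) = dinvRPstar x :=
  dinvList_ofFn _

theorem areaList_decoratedLetters {m n : ℕ} (x : RPCand m n) :
    areaList (List.ofFn (decoratedLetters x)) = areaRPstar x := by
  rw [areaList, List.map_ofFn, List.sum_ofFn, areaRPstar, Finset.sum_filter]
  refine Finset.sum_congr rfl fun i _ => ?_
  by_cases h1 : i ∈ x.2.1 <;> by_cases h2 : i ∈ x.2.2 <;> simp [decoratedLetters, h1, h2]

theorem IsRPstar.rise {m n r k j : ℕ} {x : RPCand m n} (h : IsRPstar m n r k j x)
    (i : Fin (m + n + 1)) (hi : (decoratedLetters x i).2 = true) :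
    ∃ i' : Fin (m + n + 1), i.1 = i'.1 + 1 ∧ (x.1 i : ℕ) = (x.1 i' : ℕ) + 1 := by
  simp only [decoratedLetters, decide_eq_true_eq] at hi
  rcases hi with hi | hi
  · exact (h.2.1 i hi).2
  · exact (h.2.2.2.1 i hi).2

theorem IsRPstar.isWordList {m n r k j : ℕ} {x : RPCand m n} (h : IsRPstar m n r k j x) :
    IsWordList m n r k j (List.ofFn (decoratedLetters x)) := by
  rw [isWordList_ofFn]
  refine ⟨⟨Prod.ext (h.1.1 0 rfl) ?_, fun i => ⟨h.1.2.1 _ _ (by simp), fun hi => ?_⟩⟩,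
    h.1.2.2.1, h.1.2.2.2, ?_, ?_, h.2.2.2.2.2⟩
  · rw [← Bool.not_eq_true]
    intro h0
    obtain ⟨i', hi', _⟩ := h.rise 0 h0
    simp at hi'
  · obtain ⟨i', hi', he⟩ := h.rise _ hi
    obtain rfl : i' = i.castSucc := by ext; simpa using hi'.symm
    exact he
  · rw [← h.2.2.1]
    congr 1
    ext i
    rw [Finset.mem_filter, h.mem_left_iff]
    simp
  · rw [← h.2.2.2.2.1]
    congr 1
    ext i
    rw [Finset.mem_filter, h.mem_right_iff]
    simp

theorem IsRPstar.eq_of_ofFn_eq {m n r k j : ℕ} {x y : RPCand m n} (hx : IsRPstar m n r k j x)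
    (hy : IsRPstar m n r k j y)
    (h : List.ofFn (decoratedLetters x) = List.ofFn (decoratedLetters y)) : x = y := by
  have h' := List.ofFn_injective h
  refine Prod.ext ?_ (Prod.ext ?_ ?_)
  · funext i
    exact Fin.ext (congrArg Prod.fst (congrFun h' i))
  · ext i
    rw [hx.mem_left_iff, hy.mem_left_iff, h']
  · ext i
    rw [hx.mem_right_iff, hy.mem_right_iff, h']

theorem IsWordList.exists_isRPstar {m n r k j : ℕ} {L : List (ℕ × Bool)}
    (h : IsWordList m n r k j L) :
    ∃ x : RPCand m n, IsRPstar m n r k j x ∧ L = List.ofFn (decoratedLetters x) := by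
  obtain ⟨f, rfl⟩ : ∃ f : Fin (m + n + 1) → ℕ × Bool, L = List.ofFn f :=
    ⟨fun i => L.get (i.cast h.length_eq.symm),
      List.ext_getElem (by simp [h.length_eq]) fun i h1 h2 => by rw [List.getElem_ofFn]; rfl⟩
  rw [isWordList_ofFn] at h
  obtain ⟨⟨h0, hs⟩, he, ho, hde, hdo, hz⟩ := h
  have hle : ∀ i, (f i).1 ≤ i := by
    intro i
    induction i using Fin.induction with
    | zero => simp [h0]
    | succ i ih =>
      have := (hs i).1
      simp at ih ⊢
      omega
  have hd : ∀ i, (f i).2 = true → ∃ i' : Fin (m + n + 1), i.1 = i'.1 + 1 ∧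
      (f i).1 = (f i').1 + 1 := by
    intro i
    refine Fin.cases ?_ (fun i => ?_) i
    · simp [h0]
    · exact fun hi => ⟨i.castSucc, by simp, (hs i).2 hi⟩
  let x : RPCand m n := (fun i => ⟨(f i).1, by have := hle i; omega⟩,
    univ.filter fun i => (f i).2 = true ∧ (f i).1 % 2 = 0,
    univ.filter fun i => (f i).2 = true ∧ (f i).1 % 2 = 1)
  refine ⟨x, ⟨⟨?_, ?_, he, ho⟩, ?_, hde, ?_, hdo, hz⟩, ?_⟩
  · intro i hi
    obtain rfl : i = 0 := Fin.ext hi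
    simp [x, h0]
  · intro i i' hi
    obtain ⟨l, rfl⟩ : ∃ l : Fin (m + n), i = l.castSucc :=
      ⟨⟨i, by omega⟩, rfl⟩
    obtain rfl : i' = l.succ := Fin.ext hi
    exact (hs l).1
  · intro i hi
    have hi' := (Finset.mem_filter.1 hi).2
    exact ⟨hi'.2, hd i hi'.1⟩
  · intro i hi
    have hi' := (Finset.mem_filter.1 hi).2
    exact ⟨hi'.2, hd i hi'.1⟩
  · congr 1
    funext i
    refine Prod.ext rfl ?_
    rcases Nat.mod_two_eq_zero_or_one (f i).1 with hi | hi <;> simp [x, decoratedLetters, hi]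

theorem enumerates_isWordList (m n r k j : ℕ) :
    Enumerates (IsWordList m n r k j) (fun L => qv ^ dinvList L * tv ^ areaList L)
      (RPdE m n r k j) := by
  have h : Enumerates (IsRPstar m n r k j) (fun x => qv ^ dinvRPstar x * tv ^ areaRPstar x)
      (RPdE m n r k j) := by
    refine ⟨univ.filter (IsRPstar m n r k j), fun x => by simp, ?_⟩
    rw [RPdE, if_pos (by omega)]
    simp only [Int.toNat_natCast]
  have := h.image (Q := IsWordList m n r k j)
    (g := fun L => qv ^ dinvList L * tv ^ areaList L)
    (fun x => List.ofFn (decoratedLetters x)) 1 (fun x y hx hy => hx.eq_of_ofFn_eq hy)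
    (fun x _ => by rw [dinvList_decoratedLetters, areaList_decoratedLetters, one_mul])
    (fun L => ⟨fun hL => hL.exists_isRPstar, fun ⟨x, hx, hL⟩ => hL ▸ hx.isWordList⟩)
  rwa [one_mul] at this

/-! ## The recursion -/

theorem isWordList_reduce {m n r k j : ℕ} {L : List (ℕ × Bool)} (hr : r < m + 1)
    (h : IsWordList m n r k j L) :
    1 ≤ n ∧ IsWordList (n - 1) (m + 1 - r) (cnt (fun x => x.1 = 1) L)
      (j - cnt (fun x => x.2 = true ∧ x.1 = 1) L) k (reduce L) := by
  obtain ⟨⟨l, rfl, hl⟩, he, ho, hde, hdo, hz⟩ := h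
  have hL : Follows 0 ((0, false) :: l) := ⟨by simp, by simp, hl⟩
  rw [cnt_even_eq] at he
  rw [cnt_odd_eq] at ho
  rw [cnt_decorated_odd_eq] at hdo
  rw [cnt_decorated_even_eq hL] at hde
  have hy := reductFollows_reduce hL
  rcases hy with ⟨_, hy | ⟨y', hy, hy'⟩⟩ | ⟨p', hp', _⟩
  · rw [hy, cnt_nil] at he
    omega
  · have hn : 1 ≤ n := by
      rw [hy, cnt_cons] at ho
      simp at ho
      omega
    exact ⟨hn, ⟨y', hy, hy'⟩, by omega, by omega, by omega, hde, (cnt_one_eq _).symm⟩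
  · omega

theorem isWordList_fiber_iff {m n r k j w s : ℕ} {y L : List (ℕ × Bool)} (hr : r ≤ m) (hw : w ≤ j)
    (hy : IsWordList n (m - r) s (j - w) k y) :
    ((IsWordList m (n + 1) (r + 1) k j L ∧ cnt (fun x => x.2 = true ∧ x.1 = 1) L = w) ∧
        cnt (fun x => x.1 = 1) L = s) ∧ reduce L = y ↔
      ∃ l, InFiber 0 y r w l ∧ L = (0, false) :: l := by
  constructor
  · rintro ⟨⟨⟨⟨⟨l, rfl, hl⟩, he, ho, hde, hdo, hz⟩, h1⟩, hs⟩, hry⟩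
    refine ⟨l, ⟨hl, hry, ?_, ?_⟩, rfl⟩
    · simp at hz
      omega
    · simpa using h1
  · rintro ⟨l, ⟨hl, hry, hz, h1⟩, rfl⟩
    have hL : Follows 0 ((0, false) :: l) := ⟨by simp, by simp, hl⟩
    have hry' : reduce ((0, false) :: l) = y := hry
    have hz' : cnt (fun x => x.1 = 0) ((0, false) :: l) = r + 1 := by simp [hz, add_comm]
    have h1' : cnt (fun x => x.2 = true ∧ x.1 = 1) ((0, false) :: l) = w := by simp [h1]
    obtain ⟨_, he, ho, hde, hdo, hs⟩ := hy
    refine ⟨⟨⟨⟨⟨l, rfl, hl⟩, ?_, ?_, ?_, ?_, hz'⟩, h1'⟩, ?_⟩, hry'⟩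
    · rw [cnt_even_eq, hry', hz', ho]; omega
    · rw [cnt_odd_eq, hry', he]
    · rw [cnt_decorated_even_eq hL, hry', hdo]
    · rw [cnt_decorated_odd_eq, hry', h1', hde]; omega
    · rw [cnt_one_eq, hry', hs]

theorem enumerates_isWordList_fiber {m n r k j w s : ℕ} {y : List (ℕ × Bool)}
    (hrk : r + k ≤ m) (hw : w ≤ j) (hy : IsWordList n (m - r) s (j - w) k y) :
    Enumerates (fun L => ((IsWordList m (n + 1) (r + 1) k j L ∧
        cnt (fun x => x.2 = true ∧ x.1 = 1) L = w) ∧ cnt (fun x => x.1 = 1) L = s) ∧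
          reduce L = y)
      (fun L => qv ^ dinvList L * tv ^ areaList L)
      (tv ^ (m - r - k) * zeroStart s r w * (qv ^ dinvList y * tv ^ areaList y)) := by
  have hf : ReductFollows 0 y := Or.inl ⟨rfl, Or.inr hy.1⟩
  have h := enumerates_inFiber y r 0 w hf
  rw [if_pos rfl, hy.2.2.2.2.2] at h
  have := h.image (g := fun L => qv ^ dinvList L * tv ^ areaList L) (List.cons (0, false))
    (tv ^ (m - r - k) * (qv ^ dinvList y * tv ^ areaList y))
    (fun _ _ _ _ e => (List.cons.inj e).2) ?_
    (fun L => isWordList_fiber_iff (by omega) hw hy)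
  · convert this using 1
    ring
  · intro l hl
    have hL := (isWordList_fiber_iff (L := (0, false) :: l) (by omega) hw hy).2 ⟨l, hl, rfl⟩
    obtain ⟨⟨⟨⟨⟨l', e, hl'⟩, he, _, hde, _, hz⟩, _⟩, _⟩, hry⟩ := hL
    have hF : Follows 0 ((0, false) :: l) := ⟨by simp, by simp, hl.1⟩
    have ha := areaList_eq hF
    have hd := dinvList_eq ((0, false) :: l)
    have hi : invList ((0, false) :: l) = invList l := by simp [invList]
    rw [he, hde, hz, hry] at ha
    rw [hry, hi] at hd
    rw [hd, show areaList ((0, false) :: l) = areaList y + (m - r - k) by omega, pow_add, pow_add]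
    ring

theorem enumerates_isWordList_sum {m n r k j : ℕ} (hrk : r + k ≤ m) (hrm : r < m) :
    Enumerates (IsWordList m n (r + 1) k j) (fun L => qv ^ dinvList L * tv ^ areaList L)
      (∑ w ∈ range (r + 1 + 1), ∑ s ∈ range (n + 1), tv ^ (m - r - k) * zeroStart s r w *
        RPdE ((n : ℤ) - 1) ((m - r : ℕ) : ℤ) (s : ℤ) ((j : ℤ) - (w : ℤ)) k) := by
  refine Enumerates.sum _ (cnt fun x => x.2 = true ∧ x.1 = 1) _ ?_ fun w _ =>
    Enumerates.sum _ (cnt fun x => x.1 = 1) _ ?_ fun s _ => ?_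
  · rintro L ⟨⟨l, rfl, hl⟩, -, -, -, -, hz⟩
    have := cnt_decorated_one_le hl
    simp at this hz ⊢
    omega
  · rintro L ⟨⟨-, -, ho, -⟩, -⟩
    have := cnt_one_le_cnt_odd L
    simp only [mem_range]
    omega
  · by_cases h : 1 ≤ n ∧ w ≤ j
    · obtain ⟨hn, hw⟩ := h
      obtain ⟨n, rfl⟩ := Nat.exists_eq_add_of_le' hn
      have hv := enumerates_isWordList n (m - r) s (j - w) k
      rw [show ((n : ℕ) : ℤ) = ((n + 1 : ℕ) : ℤ) - 1 by push_cast; ring,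
        show ((j - w : ℕ) : ℤ) = (j : ℤ) - (w : ℤ) by omega] at hv
      refine hv.fiber _ reduce ?_ fun y hy => enumerates_isWordList_fiber hrk hw hy
      rintro L ⟨⟨hL, rfl⟩, rfl⟩
      have := (isWordList_reduce (by omega) hL).2
      rwa [show m + 1 - (r + 1) = m - r by omega] at this
    · rw [show RPdE ((n : ℤ) - 1) ((m - r : ℕ) : ℤ) (s : ℤ) ((j : ℤ) - (w : ℤ)) k = 0 from
        if_neg (by omega), mul_zero]
      refine Enumerates.of_forall_not ?_
      rintro L ⟨⟨hL, rfl⟩, -⟩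
      refine h ⟨(isWordList_reduce (by omega) hL).1, ?_⟩
      rw [← hL.2.2.2.2.1, cnt_decorated_odd_eq]
      omega

/-- The recursion for the `(dinv, area)` q,t-enumerators of
doubly decorated reduced polyominoes. -/
theorem RPstar_recursion (m n k j r : ℤ)
    (hm : 0 ≤ m) (hn : 0 ≤ n) (hk : 0 ≤ k) (hj : 0 ≤ j)
    (hr1 : 1 ≤ r) (hrm : r ≤ m) (hrk : r + k ≤ m + 1) :
    RPdE m n r k j =
      tv ^ (m - r - k + 1).toNat *
        ∑ w ∈ Finset.range (r.toNat + 1), ∑ s ∈ Finset.range (n.toNat + 1),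
          qv ^ (w * (w - 1) / 2) * qBinomZ r (w : ℤ) *
            qBinomZ (r + (s : ℤ) - (w : ℤ) - 1) ((s : ℤ) - (w : ℤ)) *
              RPdE (n - 1) (m - r + 1) (s : ℤ) (j - (w : ℤ)) k := by
  lift m to ℕ using hm
  lift n to ℕ using hn
  lift k to ℕ using hk
  lift j to ℕ using hj
  obtain ⟨r, rfl⟩ : ∃ r' : ℕ, r = ((r' + 1 : ℕ) : ℤ) := ⟨(r - 1).toNat, by omega⟩
  rw [(enumerates_isWordList m n (r + 1) k j).unique
    (enumerates_isWordList_sum (by omega) (by omega))]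
  simp only [Int.toNat_natCast, Finset.mul_sum, qBinomZ_mul_eq_zeroStart]
  rw [show ((m : ℤ) - ((r + 1 : ℕ) : ℤ) - k + 1).toNat = m - r - k by omega,
    show (m : ℤ) - ((r + 1 : ℕ) : ℤ) + 1 = ((m - r : ℕ) : ℤ) by omega]
  simp only [mul_assoc]
end
end

section
/- For all integers m, n, k, j ≥ 0 and 1 ≤ r ≤ m+1, there is a bijection ζ from RP(m∖r, n)^{∗k,j} to RP(m∖r, n)^{∘k,j} such that for every P in the domain, dinv(P) = area(ζ(P)) and area(P) = bounce(ζ(P)); i.e. ζ maps the bistatistic (dinv, area) to (area, bounce). -/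
open Finset

attribute [local instance] Classical.propDecidable

noncomputable section

/-! ## Dyck paths as step words

A lattice path is encoded as a word `w : Fin L → Bool`, where `true` is a north
step and `false` is an east step. -/

/-- The number of north steps among the first `k` steps. -/
def nBef {L : ℕ} (w : Fin L → Bool) (k : ℕ) : ℕ :=
  (univ.filter fun i : Fin L => i.1 < k ∧ w i = true).card

/-- The number of east steps among the first `k` steps. -/
def eBef {L : ℕ} (w : Fin L → Bool) (k : ℕ) : ℕ :=
  (univ.filter fun i : Fin L => i.1 < k ∧ w i = false).card

/-- `w` is the step word of a Dyck path of size `N`: it has `N` north steps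
(hence `N` east steps) and every prefix has at least as many norths as easts,
i.e. the path stays weakly above the main diagonal. -/
def IsDyckStep (N : ℕ) (w : Fin (2 * N) → Bool) : Prop :=
  nBef w (2 * N) = N ∧ ∀ k : ℕ, k ≤ 2 * N → eBef w k ≤ nBef w k

/-- A valley: a north step directly preceded by an east step. -/
def IsValleyS {L : ℕ} (w : Fin L → Bool) (i : Fin L) : Prop :=
  w i = true ∧ ∃ j : Fin L, i.1 = j.1 + 1 ∧ w j = false

/-- A peak: a north step followed by an east step, or the last (north) step. -/
def IsPeakS {L : ℕ} (w : Fin L → Bool) (i : Fin L) : Prop :=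
  w i = true ∧ ∀ j : Fin L, j.1 = i.1 + 1 → w j = false

/-- A fall: an east step immediately followed by another east step. -/
def IsFallS {L : ℕ} (w : Fin L → Bool) (i : Fin L) : Prop :=
  w i = false ∧ ∃ j : Fin L, j.1 = i.1 + 1 ∧ w j = false

/-- A fall, where additionally the last step of the path is allowed. -/
def IsFallX {L : ℕ} (w : Fin L → Bool) (i : Fin L) : Prop :=
  w i = false ∧ (i.1 + 1 = L ∨ ∃ j : Fin L, j.1 = i.1 + 1 ∧ w j = false)

/-! ## Reduced parallelogram polyominoes: pair-of-paths model

A reduced polyomino of size `m × n` is a pair of lattice paths (red and green,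
`true` = north, `false` = east) from `(0,0)` to `(m,n)`, the red one lying
always weakly above the green one. -/

/-- The number of north steps of `w` before its `c`-th east step (for `c` larger
than the number of east steps, this is the total number of north steps). -/
def Yval {L : ℕ} (w : Fin L → Bool) (c : ℕ) : ℕ :=
  (univ.filter fun i : Fin L => w i = true ∧ eBef w i.1 < c).card

/-- The number of east steps of `w` before its `k`-th north step (for `k` larger
than the number of north steps, this is the total number of east steps). -/
def Xval {L : ℕ} (w : Fin L → Bool) (k : ℕ) : ℕ :=
  (univ.filter fun i : Fin L => w i = false ∧ nBef w i.1 < k).card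

/-- `(red, green)` is a pair of paths from `(0,0)` to `(m,n)` with red weakly
above green. -/
def IsRPPair (m n : ℕ) (red green : Fin (m + n) → Bool) : Prop :=
  nBef red (m + n) = n ∧ nBef green (m + n) = n ∧
    ∀ k : ℕ, k ≤ m + n → nBef green k ≤ nBef red k

/-- A green peak: a horizontal green step immediately following a vertical
green step. -/
def IsGreenPeak {L : ℕ} (g : Fin L → Bool) (i : Fin L) : Prop :=
  g i = false ∧ ∃ j : Fin L, i.1 = j.1 + 1 ∧ g j = true

/-- A red valley: a vertical red step immediately following a horizontal red
step; the first red step counts as a valley if it is vertical. -/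
def IsRedValley {L : ℕ} (w : Fin L → Bool) (i : Fin L) : Prop :=
  w i = true ∧ (i.1 = 0 ∨ ∃ j : Fin L, i.1 = j.1 + 1 ∧ w j = false)

/-- Candidate objects: (red path, green path, decorated green peaks,
decorated red valleys). -/
abbrev RPoCand (m n : ℕ) :=
  (Fin (m + n) → Bool) × (Fin (m + n) → Bool) × Finset (Fin (m + n)) × Finset (Fin (m + n))

/-- The `k`-th corner `(p_k, h_k)` of the bounce path of a reduced polyomino:
starting at `(0,0)` it goes east until the beginning of a vertical green step,
north until the beginning of a horizontal red step, and so on, bouncing at the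
beginning of a step of either path. -/
def bncP {L : ℕ} (red green : Fin L → Bool) : ℕ → ℕ × ℕ
  | 0 => (0, 0)
  | k + 1 =>
    let p' := Xval green ((bncP red green k).2 + 1)
    (p', Yval red (p' + 1))

/-- The letter (disregarding the bar) of the bounce word carried by the
vertical bounce step in row `y`. -/
def vLabel {L : ℕ} (red green : Fin L → Bool) (y : ℕ) : ℕ :=
  ((Finset.Icc 1 L).filter fun k => (bncP red green k).2 ≤ y).card

/-- The letter of the bounce word carried by the horizontal bounce step in
column `c`. -/
def hLabel {L : ℕ} (red green : Fin L → Bool) (c : ℕ) : ℕ :=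
  ((Finset.Icc 1 L).filter fun k => (bncP red green k).1 ≤ c).card

/-- The area: the sum of the letters of the area word of the polyomino
disregarding bars, i.e. the number of whole squares lying between the two
paths. -/
def areaRPo {m n : ℕ} (x : RPoCand m n) : ℕ :=
  ∑ c ∈ Finset.Icc 1 m, (Yval x.1 c - Yval x.2.1 c)

/-- The bounce: the sum of the letters of the bounce word disregarding bars,
not counting the barred letters (vertical bounce steps) lying in the same row
as a decorated red valley, nor the unbarred letters (horizontal bounce steps)
lying in the same column as a decorated green peak. -/
def bounceRPo {m n : ℕ} (x : RPoCand m n) : ℕ :=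
  (∑ y ∈ (Finset.range n).filter
      (fun y => y ∉ x.2.2.2.image fun i => nBef x.1 i.1), vLabel x.1 x.2.1 y) +
    ∑ c ∈ (Finset.range m).filter
      (fun c => c ∉ x.2.2.1.image fun i => eBef x.2.1 i.1), hLabel x.1 x.2.1 c

/-- Membership in `RP(m∖r, n)^{∘k, j}`: a reduced polyomino of size `m × n`
with `k` decorated green peaks, `j` decorated red valleys, and exactly `r-1`
letters equal to `0` in the bounce word (the `0` letters of the bounce word are
the horizontal steps of its initial east run). -/
def IsRPo (m n r k j : ℕ) (x : RPoCand m n) : Prop :=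
  IsRPPair m n x.1 x.2.1 ∧
    (∀ i ∈ x.2.2.1, IsGreenPeak x.2.1 i) ∧ x.2.2.1.card = k ∧
    (∀ i ∈ x.2.2.2, IsRedValley x.1 i) ∧ x.2.2.2.card = j ∧
    Xval x.2.1 1 + 1 = r

/-- The `(area, bounce)` q,t-enumerator `RP_{q,t}(m∖r, n)^{∘k, j}`;
it is `0` if some parameter is negative. -/
def RPoE (m n r k j : ℤ) : R2 :=
  if 0 ≤ m ∧ 0 ≤ n ∧ 0 ≤ r ∧ 0 ≤ k ∧ 0 ≤ j then
    ∑ x ∈ univ.filter (IsRPo m.toNat n.toNat r.toNat k.toNat j.toNat),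
      qv ^ areaRPo x * tv ^ bounceRPo x
  else 0

/-! ## Sorting the letters of a word -/

/-- The order on the positions of `w` that sorts by `⌊(letter + ε) / 2⌋`, ties being broken
by position. -/
def Prec {L : ℕ} (ε : ℕ) (w : Fin L → ℕ) (a b : Fin L) : Prop :=
  (w a + ε) / 2 < (w b + ε) / 2 ∨ ((w a + ε) / 2 = (w b + ε) / 2 ∧ a < b)

/-- The permutation listing the positions of `w` in the order `Prec ε w`. -/
def sortPerm {L : ℕ} (ε : ℕ) (w : Fin L → ℕ) : Equiv.Perm (Fin L) :=
  Tuple.sort fun i => (w i + ε) / 2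

/-- The step word obtained by reading the parities of the letters of `w` in the order
`Prec ε w`. -/
def sortPath {L : ℕ} (ε : ℕ) (w : Fin L → ℕ) : Fin L → Bool :=
  fun i => decide (w (sortPerm ε w i) % 2 = 1)

lemma sortPath_eq_true {L : ℕ} {ε : ℕ} {w : Fin L → ℕ} {i : Fin L} :
    sortPath ε w i = true ↔ w (sortPerm ε w i) % 2 = 1 := by
  simp [sortPath]

lemma sortPath_eq_false {L : ℕ} {ε : ℕ} {w : Fin L → ℕ} {i : Fin L} :
    sortPath ε w i = false ↔ w (sortPerm ε w i) % 2 = 0 := by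
  simp [sortPath]

lemma sortPerm_prec {L : ℕ} (ε : ℕ) (w : Fin L → ℕ) {i j : Fin L} (h : i < j) :
    Prec ε w (sortPerm ε w i) (sortPerm ε w j) := by
  obtain ⟨hm, ht⟩ := Tuple.eq_sort_iff.1 (rfl : sortPerm ε w = Tuple.sort _)
  rcases (hm h.le).lt_or_eq with h1 | h1
  · exact Or.inl h1
  · exact Or.inr ⟨h1, ht i j h h1⟩

lemma Prec.asymm {L : ℕ} {ε : ℕ} {w : Fin L → ℕ} {a b : Fin L} (h : Prec ε w a b) :
    ¬ Prec ε w b a := by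
  unfold Prec at *; omega

lemma prec_sortPerm_iff {L : ℕ} (ε : ℕ) (w : Fin L → ℕ) {i j : Fin L} :
    Prec ε w (sortPerm ε w i) (sortPerm ε w j) ↔ i < j := by
  refine ⟨fun h => ?_, sortPerm_prec ε w⟩
  rcases lt_trichotomy i j with h1 | h1 | h1
  · exact h1
  · subst h1; exact absurd h h.asymm
  · exact absurd h (sortPerm_prec ε w h1).asymm

lemma card_filter_sortPerm {L : ℕ} (ε : ℕ) (w : Fin L → ℕ) {P Q : Fin L → Prop}
    [DecidablePred P] [DecidablePred Q] (h : ∀ i, P i ↔ Q (sortPerm ε w i)) :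
    (univ.filter P).card = (univ.filter Q).card :=
  Finset.card_equiv (sortPerm ε w) (by simp [h])

/-- The number of positions with a letter of parity `e` that come before `a`
in the order `Prec ε w`. -/
def before {L : ℕ} (ε : ℕ) (w : Fin L → ℕ) (e : ℕ) (a : Fin L) : ℕ :=
  (univ.filter fun b => w b % 2 = e ∧ Prec ε w b a).card

lemma nBef_sortPath {L : ℕ} (ε : ℕ) (w : Fin L → ℕ) (i : Fin L) :
    nBef (sortPath ε w) i.1 = before ε w 1 (sortPerm ε w i) := by
  unfold nBef before
  refine card_filter_sortPerm ε w fun j => ?_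
  rw [prec_sortPerm_iff, sortPath_eq_true, Fin.lt_def, and_comm]

lemma eBef_sortPath {L : ℕ} (ε : ℕ) (w : Fin L → ℕ) (i : Fin L) :
    eBef (sortPath ε w) i.1 = before ε w 0 (sortPerm ε w i) := by
  unfold eBef before
  refine card_filter_sortPerm ε w fun j => ?_
  rw [prec_sortPerm_iff, sortPath_eq_false, Fin.lt_def, and_comm]

lemma nBef_sortPath_all {L : ℕ} (ε : ℕ) (w : Fin L → ℕ) :
    nBef (sortPath ε w) L = (univ.filter fun b => w b % 2 = 1).card := by
  unfold nBef
  refine card_filter_sortPerm ε w fun j => ?_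
  simp [sortPath_eq_true]

/-- The number of letters of parity `e` that are smaller than `T`. -/
def below {L : ℕ} (w : Fin L → ℕ) (e T : ℕ) : ℕ :=
  (univ.filter fun b => w b % 2 = e ∧ w b < T).card

/-- The words of letters following the initial `0` in the area word of a
reduced polyomino. -/
def IsTailWord {L : ℕ} (w : Fin L → ℕ) : Prop :=
  (∀ i, i.1 = 0 → w i ≤ 1) ∧ ∀ i j, j.1 = i.1 + 1 → w j ≤ w i + 1

lemma IsTailWord.exists_eq_of_le_of_lt {L : ℕ} {w : Fin L → ℕ} (hw : IsTailWord w) {t : ℕ}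
    {i j : Fin L} (hij : i < j) (hi : w i ≤ t) (hj : t < w j) : ∃ x, i ≤ x ∧ x < j ∧ w x = t := by
  obtain ⟨j, hjL⟩ := j
  induction j with
  | zero => exact absurd hij (by simp [Fin.lt_def])
  | succ j ih =>
    have hstep := hw.2 ⟨j, by omega⟩ ⟨j + 1, hjL⟩ rfl
    have hle : i ≤ ⟨j, by omega⟩ := by rw [Fin.lt_def] at hij; rw [Fin.le_def]; simp at *; omega
    by_cases h : w ⟨j, by omega⟩ = t
    · exact ⟨_, hle, by simp [Fin.lt_def], h⟩
    · have hne : i ≠ ⟨j, by omega⟩ := fun hi' => by rw [← hi'] at h hstep; omega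
      obtain ⟨x, h1, h2, h3⟩ := ih (by omega) (lt_of_le_of_ne hle hne) (by omega)
      exact ⟨x, h1, h2.trans (by simp [Fin.lt_def]), h3⟩

lemma IsTailWord.exists_eq_of_lt {L : ℕ} {w : Fin L → ℕ} (hw : IsTailWord w) {t : ℕ}
    {j : Fin L} (ht : 1 ≤ t) (hj : t < w j) : ∃ x, x < j ∧ w x = t := by
  have h0 := hw.1 ⟨0, j.pos⟩ rfl
  have hj0 : (⟨0, j.pos⟩ : Fin L) < j := by
    rw [Fin.lt_def]
    rcases Nat.eq_zero_or_pos j.1 with h | h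
    · have := hw.1 j h; omega
    · exact h
  obtain ⟨x, -, h2, h3⟩ := hw.exists_eq_of_le_of_lt hj0 (by omega) hj
  exact ⟨x, h2, h3⟩

lemma IsTailWord.le_pos {L : ℕ} {w : Fin L → ℕ} (hw : IsTailWord w) (i : Fin L) :
    w i ≤ i.1 + 1 := by
  obtain ⟨i, hi⟩ := i
  induction i with
  | zero => exact hw.1 _ rfl
  | succ i ih =>
    have := hw.2 ⟨i, by omega⟩ ⟨i + 1, hi⟩ rfl
    have := ih (by omega)
    simp at *; omega

lemma before_lt_below_add_one_iff {L : ℕ} {w : Fin L → ℕ} (hw : IsTailWord w) {ε e T : ℕ}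
    (he : e ≤ 1) (hε : ε = e) {a : Fin L} (ha : w a % 2 ≠ e) (hT : T % 2 ≠ e) (hT1 : 1 ≤ T + e) :
    before ε w e a < below w e T + 1 ↔ w a ≤ T := by
  subst hε
  constructor
  · intro h
    by_contra hlt
    push Not at hlt
    obtain ⟨x, hxa, hxT⟩ := hw.exists_eq_of_lt (t := T + 1) (j := a) (by omega) (by omega)
    have : below w ε T < before ε w ε a := by
      unfold before below
      apply Finset.card_lt_card
      rw [Finset.ssubset_iff_of_subset]
      · refine ⟨x, ?_, ?_⟩
        · simp only [mem_filter, mem_univ, true_and]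
          unfold Prec; omega
        · simp only [mem_filter, mem_univ, true_and]; omega
      · intro b
        simp only [mem_filter, mem_univ, true_and]
        unfold Prec
        intro hb
        omega
    omega
  · intro h
    apply Nat.lt_succ_of_le
    unfold before below
    apply Finset.card_le_card
    intro b
    simp only [mem_filter, mem_univ, true_and]
    unfold Prec
    intro hb
    omega

lemma below_le_before_iff {L : ℕ} (w : Fin L → ℕ) {ε e T : ℕ} {a : Fin L} (ha : w a % 2 = e) :
    below w e T ≤ before ε w e a ↔ T ≤ w a := by
  constructor
  · intro h
    by_contra hlt
    have : before ε w e a < below w e T := by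
      unfold before below
      apply Finset.card_lt_card
      rw [Finset.ssubset_iff_of_subset]
      · refine ⟨a, ?_, ?_⟩
        · simp only [mem_filter, mem_univ, true_and]; omega
        · simp only [mem_filter, mem_univ, true_and]; unfold Prec; omega
      · intro b
        simp only [mem_filter, mem_univ, true_and]
        unfold Prec
        intro hb
        omega
    omega
  · intro h
    unfold before below
    apply Finset.card_le_card
    intro b
    simp only [mem_filter, mem_univ, true_and]
    unfold Prec
    intro hb
    omega

lemma Xval_sortPath {L : ℕ} {w : Fin L → ℕ} (hw : IsTailWord w) (k : ℕ) :
    Xval (sortPath 1 w) (below w 1 (2 * k) + 1) = below w 0 (2 * (k + 1)) := by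
  unfold Xval
  refine card_filter_sortPerm 1 w fun i => ?_
  rw [nBef_sortPath, sortPath_eq_false]
  refine and_congr_right fun h => ?_
  rw [before_lt_below_add_one_iff hw le_rfl rfl (by omega) (by omega) (by omega)]
  omega

lemma Yval_sortPath {L : ℕ} {w : Fin L → ℕ} (hw : IsTailWord w) (k : ℕ) :
    Yval (sortPath 0 w) (below w 0 (2 * (k + 1)) + 1) = below w 1 (2 * (k + 1)) := by
  have hb : below w 0 (2 * (k + 1)) = below w 0 (2 * k + 1) := by
    unfold below; congr 1; ext b; simp only [mem_filter, mem_univ, true_and]; omega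
  unfold Yval
  rw [hb]
  refine card_filter_sortPerm 0 w fun i => ?_
  rw [eBef_sortPath, sortPath_eq_true]
  refine and_congr_right fun h => ?_
  rw [before_lt_below_add_one_iff hw zero_le_one rfl (by omega) (by omega) (by omega)]
  omega

lemma bncP_sortPath {L : ℕ} {w : Fin L → ℕ} (hw : IsTailWord w) (k : ℕ) :
    bncP (sortPath 0 w) (sortPath 1 w) k = (below w 0 (2 * k), below w 1 (2 * k)) := by
  induction k with
  | zero => simp [bncP, below]
  | succ k ih => simp only [bncP, ih, Xval_sortPath hw, Yval_sortPath hw]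

/-- The letter carried by the `i`-th step of the path `s`, read off the bounce word of the
polyomino `(red, green)`. -/
def stepLabel {L : ℕ} (red green s : Fin L → Bool) (i : Fin L) : ℕ :=
  if s i = true then 2 * vLabel red green (nBef s i.1) + 1
  else 2 * hLabel red green (eBef s i.1)

lemma card_filter_two_mul_le {L t : ℕ} (ht : t ≤ L + 1) :
    ((Finset.Icc 1 L).filter fun k => 2 * k ≤ t).card = t / 2 := by
  have : ((Finset.Icc 1 L).filter fun k => 2 * k ≤ t) = Finset.Icc 1 (t / 2) := by
    ext k; simp only [mem_filter, Finset.mem_Icc]; omega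
  rw [this]; simp

lemma vLabel_sortPath {L : ℕ} {w : Fin L → ℕ} (hw : IsTailWord w) (ε : ℕ) {i : Fin L}
    (hi : w (sortPerm ε w i) % 2 = 1) :
    vLabel (sortPath 0 w) (sortPath 1 w) (nBef (sortPath ε w) i.1) = w (sortPerm ε w i) / 2 := by
  have := hw.le_pos (sortPerm ε w i)
  rw [← card_filter_two_mul_le (L := L) (t := w (sortPerm ε w i)) (by omega)]
  unfold vLabel
  simp only [bncP_sortPath hw, nBef_sortPath, below_le_before_iff w hi]

lemma hLabel_sortPath {L : ℕ} {w : Fin L → ℕ} (hw : IsTailWord w) (ε : ℕ) {i : Fin L}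
    (hi : w (sortPerm ε w i) % 2 = 0) :
    hLabel (sortPath 0 w) (sortPath 1 w) (eBef (sortPath ε w) i.1) = w (sortPerm ε w i) / 2 := by
  have := hw.le_pos (sortPerm ε w i)
  rw [← card_filter_two_mul_le (L := L) (t := w (sortPerm ε w i)) (by omega)]
  unfold hLabel
  simp only [bncP_sortPath hw, eBef_sortPath, below_le_before_iff w hi]

lemma stepLabel_sortPath {L : ℕ} {w : Fin L → ℕ} (hw : IsTailWord w) (ε : ℕ) (i : Fin L) :
    stepLabel (sortPath 0 w) (sortPath 1 w) (sortPath ε w) i = w (sortPerm ε w i) := by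
  unfold stepLabel
  split_ifs with h
  · rw [sortPath_eq_true] at h
    rw [vLabel_sortPath hw ε h]; omega
  · rw [Bool.not_eq_true, sortPath_eq_false] at h
    rw [hLabel_sortPath hw ε h]; omega

/-! ## Counting steps of lattice paths -/

lemma nBef_mono {L : ℕ} (s : Fin L → Bool) : Monotone (nBef s) := fun a b h =>
  Finset.card_le_card fun i => by
    simp only [mem_filter, mem_univ, true_and]
    exact fun hi => ⟨hi.1.trans_le h, hi.2⟩

lemma nBef_lt_nBef {L : ℕ} {s : Fin L → Bool} {i : Fin L} (hi : s i = true) {k : ℕ}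
    (h : i.1 < k) : nBef s i.1 < nBef s k := by
  apply Finset.card_lt_card
  rw [Finset.ssubset_iff_of_subset]
  · exact ⟨i, by simpa using ⟨h, hi⟩, by simp⟩
  · intro j
    simp only [mem_filter, mem_univ, true_and]
    exact fun hj => ⟨hj.1.trans h, hj.2⟩

lemma eBef_eq_nBef_not {L : ℕ} (s : Fin L → Bool) (k : ℕ) :
    eBef s k = nBef (fun i => !s i) k := by
  unfold eBef nBef; congr 1; ext i; simp

lemma eBef_mono {L : ℕ} (s : Fin L → Bool) : Monotone (eBef s) := fun a b h => by
  simpa only [eBef_eq_nBef_not] using nBef_mono _ h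

lemma eBef_lt_eBef {L : ℕ} {s : Fin L → Bool} {i : Fin L} (hi : s i = false) {k : ℕ}
    (h : i.1 < k) : eBef s i.1 < eBef s k := by
  simpa only [eBef_eq_nBef_not] using nBef_lt_nBef (s := fun i => !s i) (by simpa using hi) h

lemma nBef_add_eBef {L : ℕ} (s : Fin L → Bool) {k : ℕ} (hk : k ≤ L) :
    nBef s k + eBef s k = k := by
  have h := Finset.card_filter_add_card_filter_not (s := univ.filter fun i : Fin L => i.1 < k)
    (fun i => s i = true)
  rw [Finset.filter_filter, Finset.filter_filter] at h
  have hc : (univ.filter fun i : Fin L => i.1 < k).card = k := by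
    rw [Fin.card_filter_val_lt]; omega
  rw [hc] at h
  simp only [Bool.not_eq_true] at h
  exact h

lemma image_nBef {L : ℕ} (s : Fin L → Bool) :
    (univ.filter fun i => s i = true).image (fun i => nBef s i.1) = range (nBef s L) := by
  apply Finset.eq_of_subset_of_card_le
  · intro y
    simp only [mem_image, mem_filter, mem_univ, true_and, Finset.mem_range]
    rintro ⟨i, hi, rfl⟩
    exact nBef_lt_nBef hi i.2
  · rw [Finset.card_image_of_injOn, Finset.card_range]
    · unfold nBef; simp
    · intro i hi j hj h
      simp only [coe_filter, mem_univ, true_and, Set.mem_ofPred_eq] at hi hj h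
      rcases lt_trichotomy i j with h1 | h1 | h1
      · exact absurd h (nBef_lt_nBef hi h1).ne
      · exact h1
      · exact absurd h (nBef_lt_nBef hj h1).ne'

lemma nBef_injOn {L : ℕ} {s : Fin L → Bool} {i j : Fin L} (hi : s i = true) (hj : s j = true)
    (h : nBef s i.1 = nBef s j.1) : i = j := by
  rcases lt_trichotomy i j with h1 | h1 | h1
  · exact absurd h (nBef_lt_nBef hi h1).ne
  · exact h1
  · exact absurd h (nBef_lt_nBef hj h1).ne'

lemma eBef_injOn {L : ℕ} {s : Fin L → Bool} {i j : Fin L} (hi : s i = false) (hj : s j = false)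
    (h : eBef s i.1 = eBef s j.1) : i = j := by
  simp only [eBef_eq_nBef_not] at h
  exact nBef_injOn (s := fun i => !s i) (by simpa using hi) (by simpa using hj) h

lemma exists_nBef_eq {L : ℕ} {s : Fin L → Bool} {y : ℕ} (hy : y < nBef s L) :
    ∃ i, s i = true ∧ nBef s i.1 = y := by
  have : y ∈ range (nBef s L) := Finset.mem_range.2 hy
  rw [← image_nBef] at this
  simpa using this

lemma exists_eBef_eq {L : ℕ} {s : Fin L → Bool} {y : ℕ} (hy : y < eBef s L) :
    ∃ i, s i = false ∧ eBef s i.1 = y := by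
  simp only [eBef_eq_nBef_not] at *
  simpa using exists_nBef_eq hy

lemma sum_nBef {L : ℕ} (s : Fin L → Bool) (f : ℕ → ℕ) :
    ∑ i ∈ univ.filter (fun i => s i = true), f (nBef s i.1) = ∑ y ∈ range (nBef s L), f y := by
  rw [← image_nBef, Finset.sum_image]
  intro i hi j hj h
  simp only [coe_filter, mem_univ, true_and, Set.mem_ofPred_eq] at hi hj
  exact nBef_injOn hi hj h

lemma sum_eBef {L : ℕ} (s : Fin L → Bool) (f : ℕ → ℕ) :
    ∑ i ∈ univ.filter (fun i => s i = false), f (eBef s i.1) = ∑ y ∈ range (eBef s L), f y := by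
  simp only [eBef_eq_nBef_not]
  rw [← sum_nBef]
  simp

lemma Yval_eBef_add_one {L : ℕ} {s : Fin L → Bool} {j : Fin L} (hj : s j = false) :
    Yval s (eBef s j.1 + 1) = nBef s j.1 := by
  unfold Yval nBef
  congr 1; ext i
  simp only [mem_filter, mem_univ, true_and]
  rw [and_comm, and_congr_left_iff]
  intro hi
  constructor
  · intro h
    by_contra hlt
    rcases (not_lt.1 hlt).lt_or_eq with h1 | h1
    · have := eBef_lt_eBef hj h1; omega
    · rw [← Fin.ext h1, hj] at hi; simp at hi
  · exact fun h => Nat.lt_succ_of_le (eBef_mono s h.le)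

lemma Xval_nBef_add_one {L : ℕ} {s : Fin L → Bool} {j : Fin L} (hj : s j = true) :
    Xval s (nBef s j.1 + 1) = eBef s j.1 := by
  have h := Yval_eBef_add_one (s := fun i => !s i) (j := j) (by simpa using hj)
  simpa [Xval, Yval, eBef_eq_nBef_not] using h

lemma Yval_mono {L : ℕ} (s : Fin L → Bool) : Monotone (Yval s) := fun a b h =>
  Finset.card_le_card fun i => by
    simp only [mem_filter, mem_univ, true_and]
    exact fun hi => ⟨hi.1, hi.2.trans_le h⟩

lemma Xval_mono {L : ℕ} (s : Fin L → Bool) : Monotone (Xval s) := fun a b h =>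
  Finset.card_le_card fun i => by
    simp only [mem_filter, mem_univ, true_and]
    exact fun hi => ⟨hi.1, hi.2.trans_le h⟩

lemma sum_Yval {L m : ℕ} {s : Fin L → Bool} (hm : eBef s L = m) :
    ∑ c ∈ Finset.Icc 1 m, Yval s c = ∑ j ∈ univ.filter (fun j => s j = false), nBef s j.1 := by
  have h1 : ∑ c ∈ Finset.Icc 1 m, Yval s c = ∑ c ∈ range m, Yval s (c + 1) := by
    rw [Finset.range_eq_Ico, Finset.sum_Ico_add']
    rfl
  rw [h1, ← hm, ← sum_eBef s fun c => Yval s (c + 1)]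
  refine Finset.sum_congr rfl fun j hj => ?_
  rw [Yval_eBef_add_one (by simpa using hj)]

/-! ## The area -/

lemma Yval_le_of_above {L : ℕ} {red green : Fin L → Bool}
    (h : ∀ k ≤ L, nBef green k ≤ nBef red k) {c : ℕ} (hr : c < eBef red L)
    (hg : c < eBef green L) : Yval green (c + 1) ≤ Yval red (c + 1) := by
  obtain ⟨i, hi, rfl⟩ := exists_eBef_eq hr
  obtain ⟨j, hj, hij⟩ := exists_eBef_eq hg
  rw [Yval_eBef_add_one hi, ← hij, Yval_eBef_add_one hj]
  by_contra hlt
  have h1 := nBef_add_eBef red i.2.le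
  have h2 := nBef_add_eBef green j.2.le
  have h3 := nBef_add_eBef red j.2.le
  have h4 := eBef_lt_eBef hi (show i.1 < j.1 by omega)
  have h5 := h j.1 j.2.le
  omega

lemma Xval_le_of_above {L : ℕ} {red green : Fin L → Bool}
    (h : ∀ k ≤ L, nBef green k ≤ nBef red k) {y : ℕ} (hr : y < nBef red L)
    (hg : y < nBef green L) : Xval red (y + 1) ≤ Xval green (y + 1) := by
  obtain ⟨i, hi, rfl⟩ := exists_nBef_eq hr
  obtain ⟨j, hj, hij⟩ := exists_nBef_eq hg
  rw [Xval_nBef_add_one hi, ← hij, Xval_nBef_add_one hj]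
  by_contra hlt
  have h1 := nBef_add_eBef red i.2.le
  have h2 := nBef_add_eBef green j.2.le
  have h3 := nBef_add_eBef green i.2.le
  have h4 := nBef_lt_nBef hj (show j.1 < i.1 by omega)
  have h5 := h i.1 i.2.le
  omega

lemma nBef_sortPath_eq {L : ℕ} (ε : ℕ) (w : Fin L → ℕ) (k : ℕ) : nBef (sortPath ε w) k =
    (univ.filter fun a => ((sortPerm ε w).symm a).1 < k ∧ w a % 2 = 1).card :=
  card_filter_sortPerm ε w fun i => by simp [sortPath_eq_true]

lemma eBef_sortPath_eq {L : ℕ} (ε : ℕ) (w : Fin L → ℕ) (k : ℕ) : eBef (sortPath ε w) k =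
    (univ.filter fun a => ((sortPerm ε w).symm a).1 < k ∧ w a % 2 = 0).card :=
  card_filter_sortPerm ε w fun i => by simp [sortPath_eq_false]

lemma prec_of_symm_lt {L : ℕ} (ε : ℕ) (w : Fin L → ℕ) {a b : Fin L}
    (h : ((sortPerm ε w).symm a).1 < ((sortPerm ε w).symm b).1) : Prec ε w a b := by
  simpa using sortPerm_prec ε w (Fin.lt_def.2 h)

lemma nBef_sortPath_le {L : ℕ} (w : Fin L → ℕ) {k : ℕ} (hk : k ≤ L) :
    nBef (sortPath 1 w) k ≤ nBef (sortPath 0 w) k := by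
  by_contra hlt
  have h1 := nBef_add_eBef (sortPath 0 w) hk
  have h2 := nBef_add_eBef (sortPath 1 w) hk
  have h3 : eBef (sortPath 1 w) k < eBef (sortPath 0 w) k := by omega
  rw [not_le] at hlt
  rw [nBef_sortPath_eq, nBef_sortPath_eq] at hlt
  rw [eBef_sortPath_eq, eBef_sortPath_eq] at h3
  obtain ⟨b, hb, hb'⟩ := Finset.exists_mem_notMem_of_card_lt_card hlt
  obtain ⟨a, ha, ha'⟩ := Finset.exists_mem_notMem_of_card_lt_card h3
  simp only [mem_filter, mem_univ, true_and] at ha ha' hb hb'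
  have p1 := prec_of_symm_lt 1 w (a := b) (b := a) (by omega)
  have p0 := prec_of_symm_lt 0 w (a := a) (b := b) (by omega)
  unfold Prec at p0 p1
  omega

lemma sum_nBef_sortPath {L : ℕ} (ε : ℕ) (w : Fin L → ℕ) :
    ∑ j ∈ univ.filter (fun j => sortPath ε w j = false), nBef (sortPath ε w) j.1 =
      (univ.filter fun p : Fin L × Fin L =>
        w p.1 % 2 = 1 ∧ w p.2 % 2 = 0 ∧ Prec ε w p.1 p.2).card := by
  have h1 : ∑ j ∈ univ.filter (fun j => sortPath ε w j = false), nBef (sortPath ε w) j.1 =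
      ∑ a ∈ univ.filter (fun a => w a % 2 = 0), before ε w 1 a :=
    Finset.sum_equiv (sortPerm ε w) (by simp [sortPath_eq_false])
      fun i _ => nBef_sortPath ε w i
  rw [h1, Finset.card_filter, Fintype.sum_prod_type_right, Finset.sum_filter]
  refine Finset.sum_congr rfl fun a _ => ?_
  split_ifs with ha
  · rw [before, Finset.card_filter]
    simp [ha]
  · simp [ha]

/-- The number of inversions of `w` whose letters differ by exactly one. -/
def tailDinv {L : ℕ} (w : Fin L → ℕ) : ℕ :=
  (univ.filter fun p : Fin L × Fin L => p.1 < p.2 ∧ w p.1 = w p.2 + 1).card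

lemma sum_nBef_sortPath_zero {L : ℕ} (w : Fin L → ℕ) :
    ∑ j ∈ univ.filter (fun j => sortPath 0 w j = false), nBef (sortPath 0 w) j.1 =
      ∑ j ∈ univ.filter (fun j => sortPath 1 w j = false), nBef (sortPath 1 w) j.1 +
        tailDinv w := by
  have h1 : tailDinv w =
      (univ.filter fun p : Fin L × Fin L =>
        p.1 < p.2 ∧ w p.1 = w p.2 + 1 ∧ w p.1 % 2 = 1).card +
      (univ.filter fun p : Fin L × Fin L =>
        p.1 < p.2 ∧ w p.1 = w p.2 + 1 ∧ w p.1 % 2 = 0).card := by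
    simp only [tailDinv, Finset.card_filter]
    rw [← Finset.sum_add_distrib]
    refine Finset.sum_congr rfl fun p _ => ?_
    split_ifs <;> omega
  have h2 : (univ.filter fun p : Fin L × Fin L =>
        p.1 < p.2 ∧ w p.1 = w p.2 + 1 ∧ w p.1 % 2 = 0).card =
      (univ.filter fun p : Fin L × Fin L =>
        p.2 < p.1 ∧ w p.2 = w p.1 + 1 ∧ w p.2 % 2 = 0).card :=
    Finset.card_equiv (Equiv.prodComm _ _) (by simp)
  rw [sum_nBef_sortPath, sum_nBef_sortPath, h1, h2]
  simp only [Finset.card_filter]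
  rw [← Finset.sum_add_distrib, ← Finset.sum_add_distrib]
  refine Finset.sum_congr rfl fun ⟨b, a⟩ _ => ?_
  have hba : a = b ∨ a < b ∨ b < a := by omega
  rcases hba with rfl | hba
  · simp [Prec]
  · unfold Prec
    simp only
    split_ifs <;> omega

lemma areaRPo_sortPath {m n : ℕ} {w : Fin (m + n) → ℕ}
    (hm : (univ.filter fun b => w b % 2 = 1).card = n) (A B : Finset (Fin (m + n))) :
    areaRPo (m := m) (n := n) (sortPath 0 w, sortPath 1 w, A, B) = tailDinv w := by
  have he : ∀ ε, eBef (sortPath ε w) (m + n) = m := fun ε => by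
    have := nBef_add_eBef (sortPath ε w) le_rfl
    rw [nBef_sortPath_all, hm] at this
    omega
  unfold areaRPo
  rw [Finset.sum_tsub_distrib, sum_Yval (he 0), sum_Yval (he 1), sum_nBef_sortPath_zero]
  · simp
  · intro c hc
    rw [Finset.mem_Icc] at hc
    obtain ⟨c, rfl⟩ : ∃ d, c = d + 1 := ⟨c - 1, by omega⟩
    exact Yval_le_of_above (fun k hk => nBef_sortPath_le w hk) (by rw [he]; omega)
      (by rw [he]; omega)

/-! ## Rises -/

/-- The letter of `w` in position `a` is the successor of the letter on its left in the word
obtained by putting the letter `0` in front of `w`. -/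
def IsTailRise {L : ℕ} (w : Fin L → ℕ) (a : Fin L) : Prop :=
  (a.1 = 0 ∧ w a = 1) ∨ ∃ b : Fin L, a.1 = b.1 + 1 ∧ w a = w b + 1

lemma exists_pred_sortPerm_iff {L : ℕ} (ε : ℕ) (w : Fin L → ℕ) (Q : Fin L → Prop) (i : Fin L) :
    (∃ j : Fin L, i.1 = j.1 + 1 ∧ Q (sortPerm ε w j)) ↔
      ∃ b, Q b ∧ Prec ε w b (sortPerm ε w i) ∧
        ∀ x, Prec ε w b x → ¬ Prec ε w x (sortPerm ε w i) := by
  constructor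
  · rintro ⟨j, hj, hQ⟩
    refine ⟨_, hQ, sortPerm_prec ε w (Fin.lt_def.2 (by omega)), fun x => ?_⟩
    obtain ⟨x, rfl⟩ := (sortPerm ε w).surjective x
    rw [prec_sortPerm_iff, prec_sortPerm_iff, Fin.lt_def, Fin.lt_def]
    omega
  · rintro ⟨b, hQ, hb, hx⟩
    obtain ⟨j, rfl⟩ := (sortPerm ε w).surjective b
    refine ⟨j, ?_, hQ⟩
    rw [prec_sortPerm_iff, Fin.lt_def] at hb
    by_contra hne
    refine hx (sortPerm ε w ⟨j.1 + 1, by omega⟩) ?_ ?_ <;>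
      (rw [prec_sortPerm_iff, Fin.lt_def]; grind)

lemma IsTailWord.isTailRise_of_cover {L : ℕ} {w : Fin L → ℕ} (hw : IsTailWord w) {ε : ℕ}
    (hε : ε ≤ 1) {a b : Fin L} (ha : w a % 2 ≠ ε) (hb : w b % 2 = ε) (hba : Prec ε w b a)
    (hx : ∀ x, Prec ε w b x → ¬ Prec ε w x a) : IsTailRise w a := by
  unfold Prec at hba hx
  have hwab : w a = w b + 1 := by
    by_contra hne
    obtain ⟨x, h1, h2⟩ := hw.exists_eq_of_lt (t := w a - 1) (j := a) (by omega) (by omega)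
    exact hx x (by omega) (by omega)
  have hlt : b < a := by omega
  refine Or.inr ⟨b, ?_, hwab⟩
  by_contra hne
  have hpos : b.1 < a.1 - 1 := by rw [Fin.lt_def] at hlt; omega
  set a' : Fin L := ⟨a.1 - 1, by omega⟩ with ha'
  have hba' : b < a' := Fin.lt_def.2 hpos
  have ha'a : a' < a := Fin.lt_def.2 (by simp [ha']; omega)
  have hstep := hw.2 a' a (by simp [ha']; omega)
  by_cases hbig : w b + 1 < w a'
  · obtain ⟨x, h1, h2, h3⟩ := hw.exists_eq_of_le_of_lt (t := w b + 1) hba' (by omega) hbig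
    have : b ≠ x := by rintro rfl; omega
    exact hx x (by omega) (by omega)
  · exact hx a' (by omega) (by omega)

lemma IsTailWord.isTailRise_of_first {L : ℕ} {w : Fin L → ℕ} (hw : IsTailWord w)
    {a : Fin L} (ha : w a % 2 = 1) (hx : ∀ x, ¬ Prec 0 w x a) : IsTailRise w a := by
  unfold Prec at hx
  have hwa : w a = 1 := by
    by_contra hne
    obtain ⟨x, h1, h2⟩ := hw.exists_eq_of_lt (t := w a - 1) (j := a) (by omega) (by omega)
    exact hx x (by omega)
  refine Or.inl ⟨?_, hwa⟩
  by_contra hne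
  set a' : Fin L := ⟨a.1 - 1, by omega⟩ with ha'
  have ha'a : a' < a := Fin.lt_def.2 (by simp [ha']; omega)
  by_cases hbig : 1 < w a'
  · obtain ⟨x, h1, h2⟩ := hw.exists_eq_of_lt le_rfl hbig
    exact hx x (by omega)
  · exact hx a' (by omega)

lemma IsTailWord.exists_pred_iff {L : ℕ} {w : Fin L → ℕ} (hw : IsTailWord w) {ε : ℕ}
    (hε : ε ≤ 1) {i : Fin L} (hi : w (sortPerm ε w i) % 2 ≠ ε) :
    ((i.1 = 0 ∧ ε = 0) ∨ ∃ j : Fin L, i.1 = j.1 + 1 ∧ w (sortPerm ε w j) % 2 = ε) ↔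
      IsTailRise w (sortPerm ε w i) := by
  rw [exists_pred_sortPerm_iff ε w (fun b => w b % 2 = ε)]
  constructor
  · rintro (⟨h0, rfl⟩ | ⟨b, hb, hba, hx⟩)
    · refine hw.isTailRise_of_first (by omega) fun x => ?_
      obtain ⟨x, rfl⟩ := (sortPerm 0 w).surjective x
      rw [prec_sortPerm_iff, Fin.lt_def]
      omega
    · exact hw.isTailRise_of_cover hε hi hb hba hx
  · rintro (⟨h0, h1⟩ | ⟨b, h0, h1⟩)
    · have hε0 : ε = 0 := by omega
      subst hε0
      refine Or.inl ⟨?_, rfl⟩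
      by_contra hne
      have := sortPerm_prec 0 w (i := ⟨0, by omega⟩) (j := i) (Fin.lt_def.2 (by simp; omega))
      unfold Prec at this
      rw [Fin.lt_def] at this
      omega
    · refine Or.inr ⟨b, by omega, ?_, fun x => ?_⟩ <;> unfold Prec <;> simp only [Fin.lt_def] <;>
        omega

/-! ## The zeta map -/

/-- The letters of an area word that follow its initial letter. -/
def tailWord {N M : ℕ} (c : Fin (N + 1) → Fin M) : Fin N → ℕ := fun i => c i.succ

/-- The polyomino whose red (green) path lists the parities of the non-initial letters of the
area word sorted by `⌊letter / 2⌋` (`⌈letter / 2⌉`), with decorations carried along. -/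
def zeta {m n : ℕ} (x : RPCand m n) : RPoCand m n :=
  (sortPath 0 (tailWord x.1), sortPath 1 (tailWord x.1),
    univ.filter (fun i => (sortPerm 1 (tailWord x.1) i).succ ∈ x.2.1),
    univ.filter (fun i => (sortPerm 0 (tailWord x.1) i).succ ∈ x.2.2))

/-- `c` starts with `0`, and each letter that is larger than the previous one is its
successor. -/
def IsAreaChain {N M : ℕ} (c : Fin (N + 1) → Fin M) : Prop :=
  (c 0 : ℕ) = 0 ∧ IsTailWord (tailWord c)

lemma IsRPWord.isAreaChain {m n : ℕ} {c : Fin (m + n + 1) → Fin (2 * (m + n + 1))}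
    (hc : IsRPWord m n c) : IsAreaChain c := by
  refine ⟨hc.1 0 rfl, fun i hi => ?_, fun i j h => hc.2.1 _ _ (by simp [h])⟩
  have h := hc.2.1 0 i.succ (by simp [hi])
  rwa [hc.1 0 rfl] at h

lemma exists_pred_eq_add_one_iff {N M : ℕ} {c : Fin (N + 1) → Fin M} (hc : IsAreaChain c)
    (a : Fin N) :
    (∃ j : Fin (N + 1), a.succ.1 = j.1 + 1 ∧ (c a.succ : ℕ) = (c j : ℕ) + 1) ↔
      IsTailRise (tailWord c) a := by
  constructor
  · rintro ⟨j, h1, h2⟩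
    rcases Fin.eq_zero_or_eq_succ j with rfl | ⟨b, rfl⟩
    · rw [hc.1] at h2
      exact Or.inl ⟨by simpa using h1, h2⟩
    · exact Or.inr ⟨b, by simpa using h1, h2⟩
  · rintro (⟨h1, h2⟩ | ⟨b, h1, h2⟩)
    · exact ⟨0, by simp [h1], by rw [hc.1]; exact h2⟩
    · exact ⟨b.succ, by simp [h1], h2⟩

lemma isGreenPeak_sortPath_iff {N M : ℕ} {c : Fin (N + 1) → Fin M} (hc : IsAreaChain c)
    (i : Fin N) : IsGreenPeak (sortPath 1 (tailWord c)) i ↔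
      IsUnbarredRise c (sortPerm 1 (tailWord c) i).succ := by
  unfold IsGreenPeak IsUnbarredRise
  rw [exists_pred_eq_add_one_iff hc]
  simp only [sortPath_eq_false, sortPath_eq_true]
  refine and_congr_right fun h => ?_
  rw [← hc.2.exists_pred_iff le_rfl (by omega)]
  simp

lemma isRedValley_sortPath_iff {N M : ℕ} {c : Fin (N + 1) → Fin M} (hc : IsAreaChain c)
    (i : Fin N) : IsRedValley (sortPath 0 (tailWord c)) i ↔
      IsBarredRise c (sortPerm 0 (tailWord c) i).succ := by
  unfold IsRedValley IsBarredRise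
  rw [exists_pred_eq_add_one_iff hc]
  simp only [sortPath_eq_false, sortPath_eq_true]
  refine and_congr_right fun h => ?_
  rw [← hc.2.exists_pred_iff zero_le_one (by omega)]
  simp

lemma forall_mem_iff_of_zero_notMem {N : ℕ} (σ : Equiv.Perm (Fin N)) {D : Finset (Fin (N + 1))}
    (h0 : 0 ∉ D) (Q : Fin (N + 1) → Prop) :
    (∀ p ∈ D, Q p) ↔ ∀ i ∈ univ.filter (fun i => (σ i).succ ∈ D), Q (σ i).succ := by
  simp only [mem_filter, mem_univ, true_and]
  refine ⟨fun h i => h _, fun h p hp => ?_⟩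
  rcases Fin.eq_zero_or_eq_succ p with rfl | ⟨a, rfl⟩
  · exact absurd hp h0
  · simpa using h (σ.symm a) (by simpa using hp)

lemma card_filter_succ_mem {N : ℕ} (σ : Equiv.Perm (Fin N)) {D : Finset (Fin (N + 1))}
    (h0 : 0 ∉ D) : (univ.filter fun i => (σ i).succ ∈ D).card = D.card := by
  refine Finset.card_bij (fun i _ => (σ i).succ) (by simp) (by simp) fun p hp => ?_
  rcases Fin.eq_zero_or_eq_succ p with rfl | ⟨a, rfl⟩
  · exact absurd hp h0
  · exact ⟨σ.symm a, by simpa using hp, by simp⟩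

lemma zero_notMem_of_isUnbarredRise {N M : ℕ} {c : Fin (N + 1) → Fin M}
    {D : Finset (Fin (N + 1))} (h : ∀ i ∈ D, IsUnbarredRise c i) : 0 ∉ D := fun h0 => by
  obtain ⟨-, j, hj, -⟩ := h 0 h0
  simp at hj

lemma zero_notMem_of_isBarredRise {N M : ℕ} {c : Fin (N + 1) → Fin M}
    {D : Finset (Fin (N + 1))} (h : ∀ i ∈ D, IsBarredRise c i) : 0 ∉ D := fun h0 => by
  obtain ⟨-, j, hj, -⟩ := h 0 h0
  simp at hj

lemma card_odd_tailWord {N M : ℕ} {c : Fin (N + 1) → Fin M} (hc : IsAreaChain c) :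
    (univ.filter fun i => (c i : ℕ) % 2 = 1).card =
      (univ.filter fun a => tailWord c a % 2 = 1).card := by
  rw [Fin.card_filter_univ_succ, hc.1, if_neg (by simp)]
  congr

lemma Xval_sortPath_one {N M : ℕ} {c : Fin (N + 1) → Fin M} (hc : IsAreaChain c) :
    Xval (sortPath 1 (tailWord c)) 1 + 1 = (univ.filter fun i => (c i : ℕ) = 0).card := by
  have h := Xval_sortPath hc.2 0
  have h0 : below (tailWord c) 1 (2 * 0) = 0 := by simp [below]
  rw [h0, zero_add] at h
  rw [h, Fin.card_filter_univ_succ, if_pos hc.1]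
  refine congrArg (· + 1) ?_
  unfold below
  refine congrArg Finset.card (Finset.ext fun a => ?_)
  simp only [mem_filter, mem_univ, true_and]
  unfold tailWord
  omega

lemma isRPWord_iff {m n : ℕ} {c : Fin (m + n + 1) → Fin (2 * (m + n + 1))}
    (hc : IsAreaChain c) : IsRPWord m n c ↔
      (univ.filter fun a => tailWord c a % 2 = 1).card = n := by
  have hsum : (univ.filter fun i => (c i : ℕ) % 2 = 0).card +
      (univ.filter fun i => (c i : ℕ) % 2 = 1).card = m + n + 1 := by
    have h := Finset.card_filter_add_card_filter_not (s := (univ : Finset (Fin (m + n + 1))))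
      (fun i => (c i : ℕ) % 2 = 0)
    simpa using h
  rw [← card_odd_tailWord hc]
  refine ⟨fun h => h.2.2.2, fun h => ⟨fun i hi => ?_, fun i j hij => ?_, by omega, h⟩⟩
  · obtain rfl : i = 0 := Fin.ext hi
    exact hc.1
  · rcases Fin.eq_zero_or_eq_succ j with rfl | ⟨b, rfl⟩
    · simp at hij
    rcases Fin.eq_zero_or_eq_succ i with rfl | ⟨a, rfl⟩
    · rw [hc.1]
      exact hc.2.1 b (by simpa using hij)
    · exact hc.2.2 a b (by simpa using hij)

lemma isRPPair_sortPath_iff {m n : ℕ} (w : Fin (m + n) → ℕ) :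
    IsRPPair m n (sortPath 0 w) (sortPath 1 w) ↔
      (univ.filter fun a => w a % 2 = 1).card = n := by
  unfold IsRPPair
  rw [nBef_sortPath_all, nBef_sortPath_all]
  exact ⟨fun h => h.1, fun h => ⟨h, h, fun k hk => nBef_sortPath_le w hk⟩⟩

lemma isRPo_zeta_iff {m n r k j : ℕ} {x : RPCand m n} (hc : IsAreaChain x.1)
    (h1 : 0 ∉ x.2.1) (h2 : 0 ∉ x.2.2) :
    IsRPo m n r k j (zeta x) ↔ IsRPstar m n r k j x := by
  unfold IsRPo IsRPstar zeta
  simp only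
  rw [isRPPair_sortPath_iff, isRPWord_iff hc, Xval_sortPath_one hc, card_filter_succ_mem _ h1,
    card_filter_succ_mem _ h2, forall_mem_iff_of_zero_notMem (sortPerm 1 (tailWord x.1)) h1,
    forall_mem_iff_of_zero_notMem (sortPerm 0 (tailWord x.1)) h2]
  simp only [isGreenPeak_sortPath_iff hc, isRedValley_sortPath_iff hc]

lemma dinvRPstar_eq_tailDinv {m n : ℕ} {x : RPCand m n} (hc : IsAreaChain x.1) :
    dinvRPstar x = tailDinv (tailWord x.1) := by
  symm
  refine Finset.card_bij (fun p _ => (p.1.succ, p.2.succ)) ?_ ?_ ?_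
  · rintro p hp
    simp only [mem_filter, mem_univ, true_and] at hp ⊢
    exact ⟨Fin.succ_lt_succ_iff.2 hp.1, hp.2⟩
  · rintro ⟨a, b⟩ - ⟨a', b'⟩ - h
    simpa using h
  · rintro ⟨a, b⟩ hp
    simp only [mem_filter, mem_univ, true_and] at hp
    rcases Fin.eq_zero_or_eq_succ a with rfl | ⟨a, rfl⟩
    · rw [hc.1] at hp; omega
    rcases Fin.eq_zero_or_eq_succ b with rfl | ⟨b, rfl⟩
    · simp at hp
    refine ⟨(a, b), ?_, rfl⟩
    simp only [mem_filter, mem_univ, true_and]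
    exact ⟨Fin.succ_lt_succ_iff.1 hp.1, hp.2⟩

lemma sum_vLabel_sortPath {L n : ℕ} {w : Fin L → ℕ} (hw : IsTailWord w)
    (hn : (univ.filter fun a => w a % 2 = 1).card = n) {E : Finset (Fin L)}
    (hE : ∀ i ∈ E, sortPath 0 w i = true) :
    ∑ y ∈ (range n).filter (fun y => y ∉ E.image fun i => nBef (sortPath 0 w) i.1),
        vLabel (sortPath 0 w) (sortPath 1 w) y =
      ∑ a, if w a % 2 = 1 ∧ (sortPerm 0 w).symm a ∉ E then w a / 2 else 0 := by
  rw [Finset.sum_filter, ← hn, ← nBef_sortPath_all 0 w, ← sum_nBef (sortPath 0 w),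
    Finset.sum_filter]
  refine Eq.trans ?_ (Equiv.sum_comp (sortPerm 0 w) _)
  refine Finset.sum_congr rfl fun i _ => ?_
  rw [Equiv.symm_apply_apply]
  by_cases hi : sortPath 0 w i = true
  · have hmem : nBef (sortPath 0 w) i.1 ∈ E.image (fun i => nBef (sortPath 0 w) i.1) ↔ i ∈ E := by
      refine ⟨fun h => ?_, fun h => mem_image_of_mem _ h⟩
      obtain ⟨j, hj, hij⟩ := mem_image.1 h
      rwa [← nBef_injOn (hE j hj) hi hij]
    have hi' := sortPath_eq_true.1 hi
    rw [if_pos hi, vLabel_sortPath hw 0 hi']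
    simp only [hmem, hi', true_and]
  · have hi' := fun h => hi (sortPath_eq_true.2 h)
    rw [if_neg hi, if_neg (fun h => hi' h.1)]

lemma sum_hLabel_sortPath {L m : ℕ} {w : Fin L → ℕ} (hw : IsTailWord w)
    (hm : eBef (sortPath 1 w) L = m) {E : Finset (Fin L)}
    (hE : ∀ i ∈ E, sortPath 1 w i = false) :
    ∑ y ∈ (range m).filter (fun y => y ∉ E.image fun i => eBef (sortPath 1 w) i.1),
        hLabel (sortPath 0 w) (sortPath 1 w) y =
      ∑ a, if w a % 2 = 0 ∧ (sortPerm 1 w).symm a ∉ E then w a / 2 else 0 := by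
  rw [Finset.sum_filter, ← hm, ← sum_eBef (sortPath 1 w),
    Finset.sum_filter]
  refine Eq.trans ?_ (Equiv.sum_comp (sortPerm 1 w) _)
  refine Finset.sum_congr rfl fun i _ => ?_
  rw [Equiv.symm_apply_apply]
  by_cases hi : sortPath 1 w i = false
  · have hmem : eBef (sortPath 1 w) i.1 ∈ E.image (fun i => eBef (sortPath 1 w) i.1) ↔ i ∈ E := by
      refine ⟨fun h => ?_, fun h => mem_image_of_mem _ h⟩
      obtain ⟨j, hj, hij⟩ := mem_image.1 h
      rwa [← eBef_injOn (hE j hj) hi hij]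
    have hi' := sortPath_eq_false.1 hi
    rw [if_pos hi, hLabel_sortPath hw 1 hi']
    simp only [hmem, hi', true_and]
  · have hi' := fun h => hi (sortPath_eq_false.2 h)
    rw [if_neg hi, if_neg (fun h => hi' h.1)]

lemma areaRPstar_eq_bounceRPo {m n r k j : ℕ} {x : RPCand m n} (hx : IsRPstar m n r k j x) :
    areaRPstar x = bounceRPo (zeta x) := by
  have hc := hx.1.isAreaChain
  have hn := (isRPWord_iff hc).1 hx.1
  have hz := (isRPo_zeta_iff hc (zero_notMem_of_isUnbarredRise hx.2.1)
    (zero_notMem_of_isBarredRise hx.2.2.2.1)).2 hx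
  have hm : eBef (sortPath 1 (tailWord x.1)) (m + n) = m := by
    have := nBef_add_eBef (sortPath 1 (tailWord x.1)) le_rfl
    rw [nBef_sortPath_all, hn] at this
    omega
  unfold bounceRPo
  have hv := sum_vLabel_sortPath hc.2 hn (E := (zeta x).2.2.2) fun i hi => (hz.2.2.2.1 i hi).1
  have hh := sum_hLabel_sortPath hc.2 hm (E := (zeta x).2.2.1) fun i hi => (hz.2.1 i hi).1
  refine Eq.trans ?_ (congrArg₂ (· + ·) hv hh).symm
  unfold areaRPstar
  rw [Finset.sum_filter, Fin.sum_univ_succ, hc.1, ← Finset.sum_add_distrib]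
  simp only [Nat.zero_div, ite_self, zero_add]
  refine Finset.sum_congr rfl fun a _ => ?_
  have hr := hx.2.1 a.succ
  have hb := hx.2.2.2.1 a.succ
  unfold IsUnbarredRise at hr
  unfold IsBarredRise at hb
  simp only [zeta, mem_filter, mem_univ, true_and, Equiv.apply_symm_apply, tailWord]
  by_cases h1 : a.succ ∈ x.2.1
  · have := (hr h1).1
    simp [h1, this]
  · by_cases h2 : a.succ ∈ x.2.2
    · have := (hb h2).1
      simp [h2, this]
    · rcases Nat.mod_two_eq_zero_or_one (x.1 a.succ) with h | h <;> simp [h1, h2, h]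

/-! ## Words determined by their subwords of consecutive letters -/

/-- The subword of `l` on the letters `ℓ` and `ℓ + 1`. -/
def pairFilter (ℓ : ℕ) (l : List ℕ) : List ℕ :=
  l.filter fun x => x == ℓ || x == ℓ + 1

lemma pairFilter_cons (ℓ x : ℕ) (l : List ℕ) : pairFilter ℓ (x :: l) =
    if x = ℓ ∨ x = ℓ + 1 then x :: pairFilter ℓ l else pairFilter ℓ l := by
  unfold pairFilter
  rw [List.filter_cons]
  congr 1
  simp

lemma mem_pairFilter {ℓ x : ℕ} {l : List ℕ} :
    x ∈ pairFilter ℓ l ↔ x ∈ l ∧ (x = ℓ ∨ x = ℓ + 1) := by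
  simp [pairFilter]

lemma count_pairFilter {ℓ x : ℕ} (h : x = ℓ ∨ x = ℓ + 1) (l : List ℕ) :
    (pairFilter ℓ l).count x = l.count x :=
  List.count_filter (by simpa using h)

lemma head?_pairFilter_ne {ℓ b : ℕ} {t : List ℕ}
    (h : (b :: t).IsChain fun x y => y ≤ x + 1) (hb : b ≤ ℓ) :
    (pairFilter ℓ (b :: t)).head? ≠ some (ℓ + 1) := by
  induction t generalizing b with
  | nil =>
    rw [pairFilter_cons]
    split_ifs <;> simp [pairFilter]
    omega
  | cons c t ih =>
    rw [pairFilter_cons]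
    rw [List.isChain_cons_cons] at h
    split_ifs with hbl
    · simp; omega
    · exact ih h.2 (by omega)

lemma eq_of_pairFilter_eq {l l' : List ℕ} (h : l.IsChain fun x y => y ≤ x + 1)
    (h' : l'.IsChain fun x y => y ≤ x + 1) (he : ∀ ℓ, pairFilter ℓ l = pairFilter ℓ l') :
    l = l' := by
  induction l generalizing l' with
  | nil =>
    cases l' with
    | nil => rfl
    | cons b' t' =>
      have := he b'
      rw [pairFilter_cons] at this
      simp [pairFilter] at this
  | cons b t ih =>
    cases l' with
    | nil =>
      have := he b
      rw [pairFilter_cons] at this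
      simp [pairFilter] at this
    | cons b' t' =>
      have hbb : b = b' := by
        rcases lt_trichotomy b b' with hlt | heq | hlt
        · obtain ⟨ℓ, rfl⟩ : ∃ ℓ, b' = ℓ + 1 := ⟨b' - 1, by omega⟩
          refine absurd ?_ (head?_pairFilter_ne (ℓ := ℓ) h (by omega))
          rw [he, pairFilter_cons]
          simp
        · exact heq
        · obtain ⟨ℓ, rfl⟩ : ∃ ℓ, b = ℓ + 1 := ⟨b - 1, by omega⟩
          refine absurd ?_ (head?_pairFilter_ne (ℓ := ℓ) h' (by omega))
          rw [← he, pairFilter_cons]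
          simp
      subst hbb
      refine congrArg (b :: ·) (ih h.tail h'.tail fun ℓ => ?_)
      have := he ℓ
      rw [pairFilter_cons, pairFilter_cons] at this
      split_ifs at this with hbl
      · exact (List.cons.inj this).2
      · exact this

lemma exists_first_letter {U : ℕ → List ℕ} (hmem : ∀ ℓ, ∀ x ∈ U ℓ, x = ℓ ∨ x = ℓ + 1)
    (hcount : ∀ ℓ, (U ℓ).count (ℓ + 1) = (U (ℓ + 1)).count (ℓ + 1)) {a : ℕ}
    (hhead : ∀ ℓ > a, (U ℓ).head? ≠ some (ℓ + 1)) (hne : ∃ ℓ, U ℓ ≠ []) :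
    ∃ b ≤ a + 1, (∀ ℓ ≥ b, (U ℓ).head? ≠ some (ℓ + 1)) ∧
      ∀ ℓ, b = ℓ ∨ b = ℓ + 1 → ∃ t, U ℓ = b :: t := by
  have hex : ∃ b, ∀ ℓ ≥ b, (U ℓ).head? ≠ some (ℓ + 1) := ⟨a + 1, fun ℓ h => hhead ℓ h⟩
  obtain ⟨b, hb, hmin⟩ : ∃ b, (∀ ℓ ≥ b, (U ℓ).head? ≠ some (ℓ + 1)) ∧
      ∀ b' < b, ¬ ∀ ℓ ≥ b', (U ℓ).head? ≠ some (ℓ + 1) :=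
    ⟨Nat.find hex, Nat.find_spec hex, fun b' => Nat.find_min hex⟩
  have hcons : ∀ ℓ ≥ b, U ℓ ≠ [] → ∃ t, U ℓ = ℓ :: t := by
    intro ℓ hℓ h0
    obtain ⟨x, t, hx⟩ := List.exists_cons_of_ne_nil h0
    have h1 := hb ℓ hℓ
    rcases hmem ℓ x (by simp [hx]) with h | h <;> subst h
    · exact ⟨t, hx⟩
    · simp [hx] at h1
  have hpred : ∀ ℓ, b = ℓ + 1 → ∃ t, U ℓ = b :: t := by
    rintro ℓ rfl
    have := hmin ℓ (by omega)
    push Not at this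
    obtain ⟨ℓ', h1, h2⟩ := this
    obtain rfl : ℓ' = ℓ := by
      by_contra hne'
      exact hb ℓ' (by omega) h2
    exact List.head?_eq_some_iff.1 h2
  refine ⟨b, ?_, hb, ?_⟩
  · by_contra hlt
    exact hmin (a + 1) (by omega) fun ℓ h => hhead ℓ h
  · rintro ℓ (rfl | h)
    · refine hcons b le_rfl fun h0 => ?_
      rcases Nat.eq_zero_or_pos b with hb0 | hb0
      · subst hb0
        have hall : ∀ ℓ, U ℓ = [] := by
          intro ℓ
          induction ℓ with
          | zero => exact h0
          | succ ℓ ih =>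
            by_contra hl
            obtain ⟨t, ht⟩ := hcons (ℓ + 1) (by omega) hl
            have := hcount ℓ
            rw [ih, ht] at this
            simp at this
        obtain ⟨ℓ, hℓ⟩ := hne
        exact hℓ (hall ℓ)
      · obtain ⟨ℓ, rfl⟩ : ∃ ℓ, b = ℓ + 1 := ⟨b - 1, by omega⟩
        obtain ⟨t, ht⟩ := hpred ℓ rfl
        have := hcount ℓ
        rw [h0, ht] at this
        simp at this
    · exact hpred ℓ h

lemma exists_pairFilter_eq {K : ℕ} (a : ℕ) {U : ℕ → List ℕ}
    (hmem : ∀ ℓ, ∀ x ∈ U ℓ, x = ℓ ∨ x = ℓ + 1)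
    (hcount : ∀ ℓ, (U ℓ).count (ℓ + 1) = (U (ℓ + 1)).count (ℓ + 1))
    (hhead : ∀ ℓ > a, (U ℓ).head? ≠ some (ℓ + 1)) (hK : ∀ ℓ ≥ K, U ℓ = []) :
    ∃ w : List ℕ, ((a :: w).IsChain fun x y => y ≤ x + 1) ∧ ∀ ℓ, pairFilter ℓ w = U ℓ := by
  induction hN : ∑ ℓ ∈ range K, (U ℓ).length using Nat.strong_induction_on generalizing a U with
  | _ N ih =>
    by_cases hne : ∃ ℓ, U ℓ ≠ []
    swap
    · push Not at hne
      exact ⟨[], by simp, fun ℓ => by simp [hne, pairFilter]⟩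
    obtain ⟨b, hba, hb, hbU⟩ := exists_first_letter hmem hcount hhead hne
    set V : ℕ → List ℕ := fun ℓ => if b = ℓ ∨ b = ℓ + 1 then (U ℓ).tail else U ℓ with hV
    have hUV : ∀ ℓ, U ℓ = if b = ℓ ∨ b = ℓ + 1 then b :: V ℓ else V ℓ := by
      intro ℓ
      simp only [hV]
      split_ifs with h
      · obtain ⟨t, ht⟩ := hbU ℓ h
        simp [ht]
      · rfl
    have hcV : ∀ ℓ x, (U ℓ).count x =
        (V ℓ).count x + if (b = ℓ ∨ b = ℓ + 1) ∧ b = x then 1 else 0 := by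
      intro ℓ x
      rw [hUV ℓ]
      by_cases h : b = ℓ ∨ b = ℓ + 1
      · simp [h, List.count_cons]
      · simp [h]
    have hVK : ∀ ℓ ≥ K, V ℓ = [] := fun ℓ h => by simp [hV, hK ℓ h]
    have hbK : b < K := by
      by_contra h
      obtain ⟨t, ht⟩ := hbU b (Or.inl rfl)
      simp [hK b (by omega)] at ht
    have hVU : ∀ ℓ, (V ℓ).length ≤ (U ℓ).length := by
      intro ℓ
      rw [hUV ℓ]
      split_ifs <;> simp
    have hlt : ∑ ℓ ∈ range K, (V ℓ).length < N := by
      rw [← hN]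
      refine Finset.sum_lt_sum (fun ℓ _ => hVU ℓ) ⟨b, Finset.mem_range.2 hbK, ?_⟩
      rw [hUV b]
      simp
    have hVmem : ∀ ℓ, ∀ x ∈ V ℓ, x = ℓ ∨ x = ℓ + 1 := by
      intro ℓ x hx
      refine hmem ℓ x ?_
      rw [hUV ℓ]
      split_ifs <;> simp [hx]
    have hVcount : ∀ ℓ, (V ℓ).count (ℓ + 1) = (V (ℓ + 1)).count (ℓ + 1) := by
      intro ℓ
      have h1 := hcV ℓ (ℓ + 1)
      have h2 := hcV (ℓ + 1) (ℓ + 1)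
      have h3 := hcount ℓ
      split_ifs at h1 h2 <;> omega
    have hVhead : ∀ ℓ > b, (V ℓ).head? ≠ some (ℓ + 1) := by
      intro ℓ hℓ
      have := hb ℓ (by omega)
      rwa [hUV ℓ, if_neg (by omega)] at this
    obtain ⟨w, hw, hwV⟩ := ih _ hlt b hVmem hVcount hVhead hVK rfl
    refine ⟨b :: w, List.isChain_cons_cons.2 ⟨hba, hw⟩, fun ℓ => ?_⟩
    rw [pairFilter_cons, hwV, hUV ℓ]

/-! ## Sorted words -/

lemma eq_of_filter_eq {f : ℕ → ℕ} {l l' : List ℕ} (h : l.Pairwise fun x y => f x ≤ f y)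
    (h' : l'.Pairwise fun x y => f x ≤ f y)
    (he : ∀ v, l.filter (fun x => f x == v) = l'.filter fun x => f x == v) : l = l' := by
  have hlt : ∀ {x x' : ℕ} {t t' : List ℕ}, (x' :: t').Pairwise (fun x y => f x ≤ f y) →
      (x :: t).filter (fun y => f y == f x) = (x' :: t').filter (fun y => f y == f x) →
      f x' ≤ f x := by
    intro x x' t t' h' he
    have hx : x ∈ (x' :: t').filter fun y => f y == f x := by rw [← he]; simp
    rcases List.mem_cons.1 (List.mem_filter.1 hx).1 with h | h
    · rw [h]
    · exact List.rel_of_pairwise_cons h' h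
  induction l generalizing l' with
  | nil =>
    cases l' with
    | nil => rfl
    | cons x' t' => simpa using he (f x')
  | cons x t ih =>
    cases l' with
    | nil => simpa using he (f x)
    | cons x' t' =>
      have hf : f x = f x' := le_antisymm (hlt h (he _).symm) (hlt h' (he _))
      have hx := he (f x)
      rw [List.filter_cons_of_pos (by simp), List.filter_cons_of_pos (by simp [hf])] at hx
      obtain rfl := (List.cons.inj hx).1
      refine congrArg (x :: ·) (ih h.tail h'.tail fun v => ?_)
      have hv := he v
      rw [List.filter_cons, List.filter_cons] at hv
      split_ifs at hv
      · exact (List.cons.inj hv).2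
      · exact hv

lemma filter_ofFn_sortPerm {L : ℕ} (ε : ℕ) (w : Fin L → ℕ) {P : ℕ → Bool}
    (hP : ∀ x y, P x = true → P y = true → (x + ε) / 2 = (y + ε) / 2) :
    (List.ofFn fun i => w (sortPerm ε w i)).filter P = (List.ofFn w).filter P := by
  have h1 : (List.ofFn fun i => w (sortPerm ε w i)) =
      ((List.finRange L).map (sortPerm ε w)).map w := by
    rw [List.map_map, List.ofFn_eq_map]
    rfl
  have h2 : ((List.finRange L).map (sortPerm ε w)).filter (P ∘ w) =
      (List.finRange L).filter (P ∘ w) := by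
    refine List.Perm.eq_of_pairwise' (r := (· < ·)) ?_ ?_ ?_
    · rw [List.filter_map, List.pairwise_map]
      refine List.Pairwise.imp_of_mem ?_ ((List.pairwise_lt_finRange L).filter _)
      intro i j hi hj hij
      have h2 := sortPerm_prec ε w hij
      have h3 := hP _ _ (List.mem_filter.1 hi).2 (List.mem_filter.1 hj).2
      unfold Prec at h2
      omega
    · exact (List.pairwise_lt_finRange L).filter _
    · exact (Equiv.Perm.map_finRange_perm _).filter _
  rw [h1, List.filter_map, h2, ← List.filter_map, ← List.ofFn_eq_map]

lemma pairFilter_ofFn_sortPerm {L : ℕ} (w : Fin L → ℕ) (ℓ : ℕ) :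
    pairFilter ℓ (List.ofFn fun i => w (sortPerm (ℓ % 2) w i)) = pairFilter ℓ (List.ofFn w) :=
  filter_ofFn_sortPerm _ w fun x y hx hy => by simp at hx hy; omega

/-! ## The bounce path of a reduced polyomino -/

lemma bncP_mono {L : ℕ} (red green : Fin L → Bool) : Monotone (bncP red green) := by
  refine monotone_nat_of_le_succ fun k => ?_
  induction k with
  | zero => exact ⟨Nat.zero_le _, Nat.zero_le _⟩
  | succ k ih =>
    have hp := Xval_mono green (Nat.succ_le_succ ih.2)
    exact ⟨hp, Yval_mono red (Nat.succ_le_succ hp)⟩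

lemma bncP_succ_fst {L : ℕ} (red green : Fin L → Bool) (k : ℕ) :
    (bncP red green (k + 1)).1 = Xval green ((bncP red green k).2 + 1) := rfl

lemma bncP_snd {L : ℕ} (red green : Fin L → Bool) {k : ℕ} (hk : 1 ≤ k) :
    (bncP red green k).2 = Yval red ((bncP red green k).1 + 1) := by
  obtain ⟨k, rfl⟩ : ∃ k', k = k' + 1 := ⟨k - 1, by omega⟩
  rfl

lemma le_card_filter_Icc_iff {f : ℕ → ℕ} (hf : Monotone f) {L t y : ℕ} (ht : 1 ≤ t)
    (htL : t ≤ L) : t ≤ ((Finset.Icc 1 L).filter fun k => f k ≤ y).card ↔ f t ≤ y := by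
  constructor
  · intro h
    by_contra hlt
    have hsub : ((Finset.Icc 1 L).filter fun k => f k ≤ y) ⊆ Finset.Icc 1 (t - 1) := by
      intro k hk
      simp only [mem_filter, Finset.mem_Icc] at hk ⊢
      refine ⟨hk.1.1, ?_⟩
      by_contra hkt
      exact hlt ((hf (show t ≤ k by omega)).trans hk.2)
    have := Finset.card_le_card hsub
    rw [Nat.card_Icc] at this
    omega
  · intro h
    have hsub : Finset.Icc 1 t ⊆ (Finset.Icc 1 L).filter fun k => f k ≤ y := by
      intro k hk
      simp only [mem_filter, Finset.mem_Icc] at hk ⊢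
      exact ⟨⟨hk.1, hk.2.trans htL⟩, (hf hk.2).trans h⟩
    have := Finset.card_le_card hsub
    rw [Nat.card_Icc] at this
    omega

lemma le_vLabel_iff {L : ℕ} (red green : Fin L → Bool) {t y : ℕ} (ht : 1 ≤ t) (htL : t ≤ L) :
    t ≤ vLabel red green y ↔ (bncP red green t).2 ≤ y :=
  le_card_filter_Icc_iff (f := fun k => (bncP red green k).2)
    (fun _ _ h => (bncP_mono red green h).2) ht htL

lemma le_hLabel_iff {L : ℕ} (red green : Fin L → Bool) {t c : ℕ} (ht : 1 ≤ t) (htL : t ≤ L) :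
    t ≤ hLabel red green c ↔ (bncP red green t).1 ≤ c :=
  le_card_filter_Icc_iff (f := fun k => (bncP red green k).1)
    (fun _ _ h => (bncP_mono red green h).1) ht htL

lemma vLabel_le {L : ℕ} (red green : Fin L → Bool) (y : ℕ) : vLabel red green y ≤ L :=
  (Finset.card_filter_le _ _).trans (by simp)

lemma hLabel_le {L : ℕ} (red green : Fin L → Bool) (c : ℕ) : hLabel red green c ≤ L :=
  (Finset.card_filter_le _ _).trans (by simp)

lemma le_vLabel_of_le {L : ℕ} {red green : Fin L → Bool} {t y : ℕ} (htL : t ≤ L)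
    (h : (bncP red green t).2 ≤ y) : t ≤ vLabel red green y := by
  rcases Nat.eq_zero_or_pos t with rfl | ht
  · exact Nat.zero_le _
  · exact (le_vLabel_iff red green ht htL).2 h

lemma le_hLabel_of_le {L : ℕ} {red green : Fin L → Bool} {t c : ℕ} (htL : t ≤ L)
    (h : (bncP red green t).1 ≤ c) : t ≤ hLabel red green c := by
  rcases Nat.eq_zero_or_pos t with rfl | ht
  · exact Nat.zero_le _
  · exact (le_hLabel_iff red green ht htL).2 h

lemma bncP_vLabel_le {L : ℕ} (red green : Fin L → Bool) (y : ℕ) :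
    (bncP red green (vLabel red green y)).2 ≤ y := by
  rcases Nat.eq_zero_or_pos (vLabel red green y) with h | h
  · rw [h]; exact Nat.zero_le _
  · exact (le_vLabel_iff red green h (vLabel_le red green y)).1 le_rfl

lemma bncP_hLabel_le {L : ℕ} (red green : Fin L → Bool) (c : ℕ) :
    (bncP red green (hLabel red green c)).1 ≤ c := by
  rcases Nat.eq_zero_or_pos (hLabel red green c) with h | h
  · rw [h]; exact Nat.zero_le _
  · exact (le_hLabel_iff red green h (hLabel_le red green c)).1 le_rfl

lemma vLabel_mono {L : ℕ} (red green : Fin L → Bool) : Monotone (vLabel red green) :=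
  fun _ _ h => le_vLabel_of_le (vLabel_le red green _) ((bncP_vLabel_le red green _).trans h)

lemma hLabel_mono {L : ℕ} (red green : Fin L → Bool) : Monotone (hLabel red green) :=
  fun _ _ h => le_hLabel_of_le (hLabel_le red green _) ((bncP_hLabel_le red green _).trans h)

lemma bncP_snd_succ {L n : ℕ} {red green : Fin L → Bool} (hr : nBef red L = n)
    (hg : nBef green L = n) (h : ∀ k ≤ L, nBef green k ≤ nBef red k) {k : ℕ}
    (hk : (bncP red green k).2 < n) : (bncP red green k).2 < (bncP red green (k + 1)).2 := by
  obtain ⟨i, hi, hik⟩ := exists_nBef_eq (s := red) (hr ▸ hk)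
  have hx := Xval_le_of_above h (hr ▸ hk) (hg ▸ hk)
  rw [← bncP_succ_fst, ← hik, Xval_nBef_add_one hi] at hx
  have hlt : nBef red i.1 < nBef red (i.1 + 1) := nBef_lt_nBef hi (Nat.lt_succ_self _)
  have hle : nBef red (i.1 + 1) ≤ Yval red (eBef red i.1 + 1) := by
    refine Finset.card_le_card fun a => ?_
    simp only [mem_filter, mem_univ, true_and]
    exact fun ha => ⟨ha.2, Nat.lt_succ_of_le (eBef_mono red (Nat.le_of_lt_succ ha.1))⟩
  have hY := Yval_mono red (Nat.succ_le_succ hx)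
  rw [bncP_snd red green (Nat.succ_le_succ (Nat.zero_le k)), ← hik]
  exact hlt.trans_le (hle.trans hY)

lemma le_bncP_snd {L n : ℕ} {red green : Fin L → Bool} (hr : nBef red L = n)
    (hg : nBef green L = n) (h : ∀ k ≤ L, nBef green k ≤ nBef red k) (k : ℕ) :
    min k n ≤ (bncP red green k).2 := by
  induction k with
  | zero => simp
  | succ k ih =>
    have hmono := (bncP_mono red green (Nat.le_succ k)).2
    by_cases hk : (bncP red green k).2 < n
    · have := bncP_snd_succ hr hg h hk
      omega
    · have : (bncP red green k).2 ≤ (bncP red green (k + 1)).2 := hmono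
      omega

/-! ## The bounce word along the two paths -/

lemma stepLabel_of_true {L : ℕ} {red green s : Fin L → Bool} {i : Fin L} (hi : s i = true) :
    stepLabel red green s i = 2 * vLabel red green (nBef s i.1) + 1 := if_pos hi

lemma stepLabel_of_false {L : ℕ} {red green s : Fin L → Bool} {i : Fin L} (hi : s i = false) :
    stepLabel red green s i = 2 * hLabel red green (eBef s i.1) := if_neg (by simp [hi])

lemma stepLabel_mod_two {L : ℕ} (red green s : Fin L → Bool) (i : Fin L) :
    stepLabel red green s i % 2 = 1 ↔ s i = true := by
  unfold stepLabel
  split_ifs with h <;> simp [h]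

lemma stepLabel_le {L : ℕ} (red green s : Fin L → Bool) (i : Fin L) :
    stepLabel red green s i ≤ 2 * L + 1 := by
  have h1 := vLabel_le red green (nBef s i.1)
  have h2 := hLabel_le red green (eBef s i.1)
  unfold stepLabel
  split_ifs <;> omega

lemma stepLabel_red_mono {L : ℕ} (red green : Fin L → Bool) {i j : Fin L} (hij : i < j) :
    stepLabel red green red i / 2 ≤ stepLabel red green red j / 2 := by
  cases hi : red i <;> cases hj : red j
  · rw [stepLabel_of_false hi, stepLabel_of_false hj]
    have := hLabel_mono red green (eBef_mono red hij.le)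
    omega
  · rw [stepLabel_of_false hi, stepLabel_of_true hj]
    suffices hLabel red green (eBef red i.1) ≤ vLabel red green (nBef red j.1) by omega
    rcases Nat.eq_zero_or_pos (hLabel red green (eBef red i.1)) with h0 | h0
    · omega
    refine le_vLabel_of_le (hLabel_le _ _ _) ?_
    rw [bncP_snd red green h0]
    refine (Yval_mono red (Nat.succ_le_succ (bncP_hLabel_le red green _))).trans ?_
    rw [Nat.succ_eq_add_one, Yval_eBef_add_one hi]
    exact nBef_mono red hij.le
  · rw [stepLabel_of_true hi, stepLabel_of_false hj]
    suffices vLabel red green (nBef red i.1) ≤ hLabel red green (eBef red j.1) by omega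
    rcases Nat.eq_zero_or_pos (vLabel red green (nBef red i.1)) with h0 | h0
    · omega
    refine le_hLabel_of_le (vLabel_le _ _ _) ?_
    by_contra hlt
    have h1 := bncP_vLabel_le red green (nBef red i.1)
    rw [bncP_snd red green h0] at h1
    have h2 := Yval_mono red (show eBef red j.1 + 1 ≤
      (bncP red green (vLabel red green (nBef red i.1))).1 + 1 by omega)
    rw [Yval_eBef_add_one hj] at h2
    have h3 := nBef_lt_nBef hi hij
    omega
  · rw [stepLabel_of_true hi, stepLabel_of_true hj]
    have := vLabel_mono red green (nBef_mono red hij.le)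
    omega

lemma stepLabel_green_mono {L n : ℕ} {red green : Fin L → Bool} (hr : nBef red L = n)
    (hg : nBef green L = n) (h : ∀ k ≤ L, nBef green k ≤ nBef red k) {i j : Fin L}
    (hij : i < j) :
    (stepLabel red green green i + 1) / 2 ≤ (stepLabel red green green j + 1) / 2 := by
  cases hi : green i <;> cases hj : green j
  · rw [stepLabel_of_false hi, stepLabel_of_false hj]
    have := hLabel_mono red green (eBef_mono green hij.le)
    omega
  · rw [stepLabel_of_false hi, stepLabel_of_true hj]
    suffices hLabel red green (eBef green i.1) ≤ vLabel red green (nBef green j.1) + 1 by omega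
    obtain h0 | ⟨t, ht⟩ : hLabel red green (eBef green i.1) = 0 ∨
        ∃ t, hLabel red green (eBef green i.1) = t + 1 := by
      cases hLabel red green (eBef green i.1) <;> simp
    · omega
    have htL := hLabel_le red green (eBef green i.1)
    have h1 := bncP_hLabel_le red green (eBef green i.1)
    rw [ht] at htL h1 ⊢
    refine Nat.succ_le_succ (le_vLabel_of_le (by omega) ?_)
    by_contra hlt
    rw [bncP_succ_fst] at h1
    have h2 := Xval_mono green (show nBef green j.1 + 1 ≤ (bncP red green t).2 + 1 by omega)
    rw [Xval_nBef_add_one hj] at h2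
    have h3 := eBef_lt_eBef hi hij
    omega
  · rw [stepLabel_of_true hi, stepLabel_of_false hj]
    suffices vLabel red green (nBef green i.1) + 1 ≤ hLabel red green (eBef green j.1) by omega
    have h1 := bncP_vLabel_le red green (nBef green i.1)
    have hn : nBef green i.1 < n := hg ▸ nBef_lt_nBef hi i.2
    have hL : n ≤ L := by have := nBef_add_eBef red le_rfl; omega
    have htL := vLabel_le red green (nBef green i.1)
    have hne : vLabel red green (nBef green i.1) ≠ L := by
      intro he
      have := le_bncP_snd hr hg h L
      rw [he] at h1
      omega
    refine le_hLabel_of_le (by omega) ?_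
    rw [bncP_succ_fst]
    refine (Xval_mono green (Nat.succ_le_succ h1)).trans ?_
    rw [Nat.succ_eq_add_one, Xval_nBef_add_one hi]
    exact eBef_mono green hij.le
  · rw [stepLabel_of_true hi, stepLabel_of_true hj]
    have := vLabel_mono red green (nBef_mono green hij.le)
    omega

lemma exists_stepLabel_red_eq {L : ℕ} {red green : Fin L → Bool} {v : ℕ} (hv : 1 ≤ v)
    {j : Fin L} (hj : stepLabel red green red j = 2 * v + 1) :
    ∃ i < j, stepLabel red green red i = 2 * v := by
  have hjt : red j = true := by rw [← stepLabel_mod_two red green]; omega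
  rw [stepLabel_of_true hjt] at hj
  have hv' : vLabel red green (nBef red j.1) = v := by omega
  have hvL := vLabel_le red green (nBef red j.1)
  have hle := bncP_vLabel_le red green (nBef red j.1)
  rw [hv'] at hvL hle
  have hY := bncP_snd red green hv
  have hp : (bncP red green v).1 < eBef red L := by
    by_contra hge
    have : Yval red ((bncP red green v).1 + 1) = nBef red L := by
      unfold Yval nBef
      congr 1
      ext i
      have := eBef_mono red i.2.le
      simp only [mem_filter, mem_univ, true_and, and_iff_left (show eBef red i.1 <
        (bncP red green v).1 + 1 by omega), i.2]
    have := nBef_lt_nBef hjt j.2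
    omega
  obtain ⟨i, hi, hip⟩ := exists_eBef_eq hp
  rw [← hip, Yval_eBef_add_one hi] at hY
  refine ⟨i, ?_, ?_⟩
  · rcases lt_trichotomy i j with h | rfl | h
    · exact h
    · rw [hi] at hjt; cases hjt
    · have := nBef_lt_nBef hjt h; omega
  · rw [stepLabel_of_false hi, hip]
    refine congrArg (2 * ·) (le_antisymm ?_ (le_hLabel_of_le hvL le_rfl))
    by_contra hlt
    have h1 : v + 1 ≤ hLabel red green (bncP red green v).1 := by omega
    have h2 := h1.trans (hLabel_le red green _)
    rw [le_hLabel_iff red green (by omega) h2] at h1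
    have h3 := Yval_mono red (Nat.succ_le_succ h1)
    rw [Nat.succ_eq_add_one, ← bncP_snd red green (by omega), ← hip, Nat.succ_eq_add_one,
      Yval_eBef_add_one hi] at h3
    have h4 := le_vLabel_of_le (red := red) (green := green) (y := nBef red j.1) h2 (by omega)
    omega

lemma exists_stepLabel_green_eq {L n : ℕ} {red green : Fin L → Bool} (hr : nBef red L = n)
    (hg : nBef green L = n) (h : ∀ k ≤ L, nBef green k ≤ nBef red k) {v : ℕ}
    {j : Fin L} (hj : stepLabel red green green j = 2 * v + 2) :
    ∃ i < j, stepLabel red green green i = 2 * v + 1 := by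
  have hjt : green j = false := by
    rw [← Bool.not_eq_true, ← stepLabel_mod_two red green]; omega
  rw [stepLabel_of_false hjt] at hj
  have hv' : hLabel red green (eBef green j.1) = v + 1 := by omega
  have hvL := hLabel_le red green (eBef green j.1)
  have hle := bncP_hLabel_le red green (eBef green j.1)
  rw [hv'] at hvL hle
  rw [bncP_succ_fst] at hle
  have hp : (bncP red green v).2 < n := by
    by_contra hge
    have : Xval green ((bncP red green v).2 + 1) = eBef green L := by
      unfold Xval eBef
      congr 1
      ext i
      have := nBef_mono green i.2.le
      simp only [mem_filter, mem_univ, true_and, and_iff_left (show nBef green i.1 <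
        (bncP red green v).2 + 1 by omega), i.2]
    have := eBef_lt_eBef hjt j.2
    omega
  obtain ⟨i, hi, hip⟩ := exists_nBef_eq (s := green) (hg ▸ hp)
  rw [← hip, Xval_nBef_add_one hi] at hle
  refine ⟨i, ?_, ?_⟩
  · rcases lt_trichotomy i j with h | rfl | h
    · exact h
    · rw [hi] at hjt; cases hjt
    · have := eBef_lt_eBef hjt h; omega
  · rw [stepLabel_of_true hi, hip]
    refine congrArg (2 * · + 1) (le_antisymm ?_ (le_vLabel_of_le (by omega) le_rfl))
    by_contra hlt
    have h1 : v + 1 ≤ vLabel red green (bncP red green v).2 := by omega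
    rw [le_vLabel_iff red green (by omega) hvL] at h1
    have h2 := bncP_snd_succ hr hg h hp
    omega

lemma count_ofFn {L : ℕ} (f : Fin L → ℕ) (x : ℕ) :
    (List.ofFn f).count x = ∑ i, if f i = x then 1 else 0 := by
  induction L with
  | zero => simp
  | succ L ih =>
    rw [List.ofFn_succ, List.count_cons, ih, Fin.sum_univ_succ, add_comm]
    simp

lemma count_stepLabel {L : ℕ} (red green s : Fin L → Bool) (x : ℕ) :
    (List.ofFn (stepLabel red green s)).count x =
      (∑ y ∈ range (nBef s L), if 2 * vLabel red green y + 1 = x then 1 else 0) +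
        ∑ c ∈ range (eBef s L), if 2 * hLabel red green c = x then 1 else 0 := by
  rw [count_ofFn, ← sum_nBef s, ← sum_eBef s, Finset.sum_filter, Finset.sum_filter,
    ← Finset.sum_add_distrib]
  refine Finset.sum_congr rfl fun i _ => ?_
  cases hi : s i
  · rw [stepLabel_of_false hi]; simp
  · rw [stepLabel_of_true hi]; simp

lemma count_stepLabel_red_eq_green {L : ℕ} {red green : Fin L → Bool}
    (h : nBef red L = nBef green L) (x : ℕ) :
    (List.ofFn (stepLabel red green red)).count x =
      (List.ofFn (stepLabel red green green)).count x := by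
  have h1 := nBef_add_eBef red le_rfl
  have h2 := nBef_add_eBef green le_rfl
  rw [count_stepLabel, count_stepLabel, h, show eBef red L = eBef green L by omega]

/-! ## Bijectivity -/

lemma isTailWord_iff_isChain {L : ℕ} {w : Fin L → ℕ} :
    IsTailWord w ↔ (0 :: List.ofFn w).IsChain fun x y => y ≤ x + 1 := by
  cases L with
  | zero => simp [IsTailWord]
  | succ L =>
    rw [List.isChain_iff_getElem]
    constructor
    · rintro ⟨h0, h1⟩ i hi
      simp only [List.length_cons, List.length_ofFn] at hi
      cases i with
      | zero => simpa using h0 0 rfl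
      | succ i =>
        simp only [List.getElem_cons_succ, List.getElem_ofFn]
        exact h1 ⟨i, by omega⟩ ⟨i + 1, by omega⟩ rfl
    · intro h
      refine ⟨fun i hi => ?_, fun i j hij => ?_⟩
      · obtain rfl : i = 0 := Fin.ext hi
        simpa using h 0 (by simp)
      · obtain ⟨j, hj⟩ := j
        simp only at hij
        subst hij
        have := h (i.1 + 1) (by simpa using hj)
        simpa only [List.getElem_cons_succ, List.getElem_ofFn] using this

lemma eq_of_sortPath_eq {L : ℕ} {w w' : Fin L → ℕ} (hw : IsTailWord w) (hw' : IsTailWord w')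
    (h0 : sortPath 0 w = sortPath 0 w') (h1 : sortPath 1 w = sortPath 1 w') : w = w' := by
  have hs : ∀ ε ≤ 1, ∀ i, w (sortPerm ε w i) = w' (sortPerm ε w' i) := by
    intro ε hε i
    have hε' : sortPath ε w = sortPath ε w' := by
      obtain rfl | rfl : ε = 0 ∨ ε = 1 := by omega
      · exact h0
      · exact h1
    rw [← stepLabel_sortPath hw, ← stepLabel_sortPath hw', h0, h1, hε']
  refine List.ofFn_injective (eq_of_pairFilter_eq (isTailWord_iff_isChain.1 hw).tail
    (isTailWord_iff_isChain.1 hw').tail fun ℓ => ?_)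
  rw [← pairFilter_ofFn_sortPerm, ← pairFilter_ofFn_sortPerm w']
  simp only [hs _ (show ℓ % 2 ≤ 1 by omega)]

lemma head?_pairFilter_ofFn_ne {L ℓ : ℕ} {f : Fin L → ℕ}
    (h : ∀ j, f j = ℓ + 1 → ∃ i < j, f i = ℓ) :
    (pairFilter ℓ (List.ofFn f)).head? ≠ some (ℓ + 1) := by
  unfold pairFilter
  rw [List.head?_filter]
  intro hf
  obtain ⟨-, j, hj, hjf, hlt⟩ := List.find?_eq_some_iff_getElem.1 hf
  rw [List.getElem_ofFn] at hjf
  obtain ⟨i, hij, hi⟩ := h _ hjf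
  have := hlt i.1 hij
  simp [hi] at this

lemma ofFn_sortPerm_pairwise {L : ℕ} (ε : ℕ) (w : Fin L → ℕ) :
    (List.ofFn fun i => w (sortPerm ε w i)).Pairwise fun x y => (x + ε) / 2 ≤ (y + ε) / 2 := by
  rw [List.pairwise_ofFn]
  intro i j hij
  have := sortPerm_prec ε w hij
  unfold Prec at this
  omega

/-- The red and green words, alternately used to prescribe the subwords of an area word on two
consecutive letters. -/
def prescribed {L : ℕ} (red green : Fin L → Bool) (ℓ : ℕ) : List ℕ :=
  List.ofFn (stepLabel red green (if ℓ % 2 = 0 then red else green))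

lemma prescribed_of_even {L : ℕ} (red green : Fin L → Bool) {ℓ : ℕ} (h : ℓ % 2 = 0) :
    prescribed red green ℓ = List.ofFn (stepLabel red green red) := by
  rw [prescribed, if_pos h]

lemma prescribed_of_odd {L : ℕ} (red green : Fin L → Bool) {ℓ : ℕ} (h : ℓ % 2 = 1) :
    prescribed red green ℓ = List.ofFn (stepLabel red green green) := by
  rw [prescribed, if_neg (by omega)]

lemma count_prescribed {L : ℕ} {red green : Fin L → Bool} (h : nBef red L = nBef green L)
    (ℓ x : ℕ) : (prescribed red green ℓ).count x =
      (List.ofFn (stepLabel red green red)).count x := by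
  rcases Nat.mod_two_eq_zero_or_one ℓ with hℓ | hℓ
  · rw [prescribed_of_even _ _ hℓ]
  · rw [prescribed_of_odd _ _ hℓ, count_stepLabel_red_eq_green h]

lemma exists_list_pairFilter_eq {L n : ℕ} {red green : Fin L → Bool} (hr : nBef red L = n)
    (hg : nBef green L = n) (h : ∀ k ≤ L, nBef green k ≤ nBef red k) :
    ∃ l : List ℕ, ((0 :: l).IsChain fun x y => y ≤ x + 1) ∧
      ∀ ℓ, pairFilter ℓ l = pairFilter ℓ (prescribed red green ℓ) := by
  refine exists_pairFilter_eq (K := 2 * L + 2) 0 (fun ℓ x hx => (mem_pairFilter.1 hx).2)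
    (fun ℓ => ?_) (fun ℓ hℓ => ?_) (fun ℓ hℓ => ?_)
  · rw [count_pairFilter (Or.inr rfl), count_pairFilter (Or.inl rfl),
      count_prescribed (hr.trans hg.symm), count_prescribed (hr.trans hg.symm)]
  · rcases Nat.mod_two_eq_zero_or_one ℓ with h2 | h2
    · rw [prescribed_of_even _ _ h2]
      obtain ⟨v, rfl⟩ : ∃ v, ℓ = 2 * v := ⟨ℓ / 2, by omega⟩
      exact head?_pairFilter_ofFn_ne fun j hj => exists_stepLabel_red_eq (by omega) hj
    · rw [prescribed_of_odd _ _ h2]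
      obtain ⟨v, rfl⟩ : ∃ v, ℓ = 2 * v + 1 := ⟨ℓ / 2, by omega⟩
      exact head?_pairFilter_ofFn_ne fun j hj => exists_stepLabel_green_eq hr hg h hj
  · rw [List.eq_nil_iff_forall_not_mem]
    intro x hx
    rw [mem_pairFilter, prescribed, List.mem_ofFn] at hx
    obtain ⟨⟨i, rfl⟩, hi⟩ := hx
    have := stepLabel_le red green (if ℓ % 2 = 0 then red else green) i
    omega

lemma sortPath_eq_of_ofFn_eq {L : ℕ} {ε : ℕ} {w : Fin L → ℕ} {red green s : Fin L → Bool}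
    (h : (List.ofFn fun i => w (sortPerm ε w i)) = List.ofFn (stepLabel red green s)) :
    sortPath ε w = s := by
  funext i
  rw [Bool.eq_iff_iff, sortPath_eq_true, ← stepLabel_mod_two red green s i,
    congrFun (List.ofFn_injective h) i]

lemma exists_sortPath_eq {L n : ℕ} {red green : Fin L → Bool} (hr : nBef red L = n)
    (hg : nBef green L = n) (h : ∀ k ≤ L, nBef green k ≤ nBef red k) :
    ∃ w : Fin L → ℕ, IsTailWord w ∧ sortPath 0 w = red ∧ sortPath 1 w = green := by
  obtain ⟨l, hl, hlf⟩ := exists_list_pairFilter_eq hr hg h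
  have hcount : ∀ x, l.count x = (List.ofFn (stepLabel red green red)).count x := fun x => by
    rw [← count_pairFilter (Or.inl rfl) l, hlf, count_pairFilter (Or.inl rfl),
      count_prescribed (hr.trans hg.symm)]
  have hlen : l.length = L := by
    simpa using (List.perm_iff_count.2 hcount).length_eq
  obtain ⟨w, rfl⟩ : ∃ w : Fin L → ℕ, List.ofFn w = l := by
    subst hlen
    exact ⟨l.get, List.ofFn_get l⟩
  refine ⟨w, isTailWord_iff_isChain.2 hl, sortPath_eq_of_ofFn_eq (red := red) (green := green) ?_,
    sortPath_eq_of_ofFn_eq (red := red) (green := green) ?_⟩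
  · refine eq_of_filter_eq (f := fun x => (x + 0) / 2) (ofFn_sortPerm_pairwise 0 w) ?_ fun v => ?_
    · rw [List.pairwise_ofFn]
      exact fun i j hij => stepLabel_red_mono red green hij
    · have hp : (fun x => (x + 0) / 2 == v) = fun x => x == 2 * v || x == 2 * v + 1 := by
        funext x
        rw [Bool.eq_iff_iff]
        simp
        omega
      have h1 := pairFilter_ofFn_sortPerm w (2 * v)
      rw [hlf, prescribed_of_even _ _ (by omega), show 2 * v % 2 = 0 by omega] at h1
      rw [hp]
      exact h1
  · refine eq_of_filter_eq (f := fun x => (x + 1) / 2) (ofFn_sortPerm_pairwise 1 w) ?_ fun v => ?_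
    · rw [List.pairwise_ofFn]
      exact fun i j hij => stepLabel_green_mono hr hg h hij
    · cases v with
      | zero =>
        have hp : (fun x => (x + 1) / 2 == 0) = fun x => x == 0 := by
          funext x
          rw [Bool.eq_iff_iff]
          simp
        rw [hp, filter_ofFn_sortPerm 1 w (by simp +contextual), List.filter_beq, List.filter_beq,
          hcount, count_stepLabel_red_eq_green (hr.trans hg.symm)]
      | succ v =>
        have hp : (fun x => (x + 1) / 2 == v + 1) =
            fun x => x == 2 * v + 1 || x == 2 * v + 1 + 1 := by
          funext x
          rw [Bool.eq_iff_iff]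
          simp
          omega
        have h1 := pairFilter_ofFn_sortPerm w (2 * v + 1)
        rw [hlf, prescribed_of_odd _ _ (by omega), show (2 * v + 1) % 2 = 1 by omega] at h1
        rw [hp]
        exact h1

lemma IsRPstar.isAreaChain {m n r k j : ℕ} {x : RPCand m n} (hx : IsRPstar m n r k j x) :
    IsAreaChain x.1 := hx.1.isAreaChain

lemma IsRPstar.isRPo_zeta {m n r k j : ℕ} {x : RPCand m n} (hx : IsRPstar m n r k j x) :
    IsRPo m n r k j (zeta x) :=
  (isRPo_zeta_iff hx.isAreaChain (zero_notMem_of_isUnbarredRise hx.2.1)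
    (zero_notMem_of_isBarredRise hx.2.2.2.1)).2 hx

lemma eq_of_filter_succ_mem_eq {N : ℕ} (σ : Equiv.Perm (Fin N)) {D D' : Finset (Fin (N + 1))}
    (h0 : 0 ∉ D) (h0' : 0 ∉ D')
    (h : (univ.filter fun i => (σ i).succ ∈ D) = univ.filter fun i => (σ i).succ ∈ D') :
    D = D' := by
  ext p
  rcases Fin.eq_zero_or_eq_succ p with rfl | ⟨a, rfl⟩
  · simp [h0, h0']
  · simpa using Finset.ext_iff.1 h (σ.symm a)

lemma IsRPstar.eq_of_zeta_eq {m n r k j : ℕ} {x x' : RPCand m n} (hx : IsRPstar m n r k j x)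
    (hx' : IsRPstar m n r k j x') (h : zeta x = zeta x') : x = x' := by
  obtain ⟨c, D₁, D₂⟩ := x
  obtain ⟨c', D₁', D₂'⟩ := x'
  simp only [zeta, Prod.mk.injEq] at h
  obtain ⟨h0, h1, h2, h3⟩ := h
  have hw : tailWord c = tailWord c' :=
    eq_of_sortPath_eq hx.isAreaChain.2 hx'.isAreaChain.2 h0 h1
  have hc : c = c' := by
    funext i
    rw [Fin.ext_iff]
    rcases Fin.eq_zero_or_eq_succ i with rfl | ⟨a, rfl⟩
    · exact hx.isAreaChain.1.trans hx'.isAreaChain.1.symm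
    · exact congrFun hw a
  subst hc
  have hD₁ : D₁ = D₁' := eq_of_filter_succ_mem_eq _ (zero_notMem_of_isUnbarredRise hx.2.1)
    (zero_notMem_of_isUnbarredRise hx'.2.1) h2
  have hD₂ : D₂ = D₂' := eq_of_filter_succ_mem_eq _ (zero_notMem_of_isBarredRise hx.2.2.2.1)
    (zero_notMem_of_isBarredRise hx'.2.2.2.1) h3
  rw [hD₁, hD₂]

lemma exists_filter_succ_mem_eq {N : ℕ} (σ : Equiv.Perm (Fin N)) (E : Finset (Fin N)) :
    ∃ D : Finset (Fin (N + 1)), 0 ∉ D ∧ (univ.filter fun i => (σ i).succ ∈ D) = E :=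
  ⟨E.image fun i => (σ i).succ, by simp, by ext i; simp⟩

lemma IsRPo.exists_zeta_eq {m n r k j : ℕ} {y : RPoCand m n} (hy : IsRPo m n r k j y) :
    ∃ x, IsRPstar m n r k j x ∧ zeta x = y := by
  obtain ⟨red, green, E₁, E₂⟩ := y
  obtain ⟨w, hw, h0, h1⟩ := exists_sortPath_eq hy.1.1 hy.1.2.1 hy.1.2.2
  obtain ⟨D₁, hD₁, hE₁⟩ := exists_filter_succ_mem_eq (sortPerm 1 w) E₁
  obtain ⟨D₂, hD₂, hE₂⟩ := exists_filter_succ_mem_eq (sortPerm 0 w) E₂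
  set c : Fin (m + n + 1) → Fin (2 * (m + n + 1)) :=
    Fin.cons 0 fun i => ⟨w i, by have := hw.le_pos i; omega⟩ with hc
  have hcw : tailWord c = w := by
    funext i
    simp [tailWord, hc]
  have hchain : IsAreaChain c := ⟨by simp [hc], by rwa [hcw]⟩
  have hz : zeta (c, D₁, D₂) = (red, green, E₁, E₂) := by
    simp only [zeta, hcw, h0, hE₁, hE₂]
    exact congrArg (fun s => (red, s, E₁, E₂)) h1
  exact ⟨_, (isRPo_zeta_iff (x := (c, D₁, D₂)) hchain hD₁ hD₂).1 (by rwa [hz]), hz⟩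

/-- There is a bijection `ζ` from `RP(m∖r, n)^{∗k,j}` to
`RP(m∖r, n)^{∘k,j}` mapping the bistatistic `(dinv, area)` to `(area, bounce)`. -/
theorem zeta_bijection (m n k j r : ℕ) (hr1 : 1 ≤ r) (hrm : r ≤ m + 1) :
    ∃ ζ : {x : RPCand m n // IsRPstar m n r k j x} →
        {y : RPoCand m n // IsRPo m n r k j y},
      Function.Bijective ζ ∧
        ∀ P, dinvRPstar P.1 = areaRPo (ζ P).1 ∧ areaRPstar P.1 = bounceRPo (ζ P).1 := by
  refine ⟨fun P => ⟨zeta P.1, P.2.isRPo_zeta⟩, ⟨fun P Q h => ?_, fun y => ?_⟩, fun P => ⟨?_, ?_⟩⟩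
  · exact Subtype.ext (P.2.eq_of_zeta_eq Q.2 (congrArg Subtype.val h))
  · obtain ⟨x, hx, hxy⟩ := y.2.exists_zeta_eq
    exact ⟨⟨x, hx⟩, Subtype.ext hxy⟩
  · rw [dinvRPstar_eq_tailDinv P.2.isAreaChain]
    exact (areaRPo_sortPath ((isRPWord_iff P.2.isAreaChain).1 P.2.1) _ _).symm
  · exact areaRPstar_eq_bounceRPo P.2
end
end
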